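/- arXiv:1402.5298 — 2 statements merged into one kernel-verified Lean document; each statement's English description precedes it below -/
import Mathlib

section
/- Let d₁ ≥ 1 and define, for a ∈ ℝ∖{0}, k ∈ ℕ and x, y ∈ ℝ^{d₁}, F_{k,a}(x,y) = (2π)^{−d₁} |a|^{d₁} ∫_{ℝ^{d₁}} e^{i(a/2) ξ·(x+y)} L_k^{d₁−1}((|a|/2)(|ξ|² + |x−y|²)) e^{−(|a|/4)(|ξ|² + |x−y|²)} dξ. Then there is a constant C > 0, independent of k, a, x, y, such that |F_{k,a}(x,y)| ≤ C |a|^{d₁/2} (2k + d₁)^{(d₁−1)/2}. -/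
open MeasureTheory
open scoped ENNReal

noncomputable section

/-- Laguerre polynomial of type `δ` and degree `k`. -/
def laguerreL (k : ℕ) (δ : ℝ) (τ : ℝ) : ℝ :=
  (1 / (Nat.factorial k : ℝ)) * Real.exp τ * τ ^ (-δ) *
    iteratedDeriv k (fun s : ℝ => Real.exp (-s) * s ^ ((k : ℝ) + δ)) τ

/-- the kernel F_{k,a}(x,y) of the projection P_k(a) -/
def projKernel (d : ℕ) (k : ℕ) (a : ℝ) (x y : Fin d → ℝ) : ℂ :=
  (((2 * Real.pi) ^ (-(d : ℝ)) * |a| ^ d : ℝ) : ℂ) *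
    ∫ ξ : Fin d → ℝ,
      Complex.exp (Complex.I * (a / 2 * ∑ j, ξ j * (x j + y j) : ℝ)) *
        ((laguerreL k ((d : ℝ) - 1) (|a| / 2 * ((∑ j, ξ j ^ 2) + ∑ j, (x j - y j) ^ 2)) *
          Real.exp (-|a| / 4 * ((∑ j, ξ j ^ 2) + ∑ j, (x j - y j) ^ 2)) : ℝ) : ℂ)

end

/-- The explicit coefficients of the Laguerre polynomial of natural type. -/
theorem laguerreL_natCast (k n : ℕ) {τ : ℝ} (hτ : 0 < τ) :
    laguerreL k n τ = ∑ j ∈ Finset.range (k + 1),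
      (-τ) ^ j / (j.factorial : ℝ) * ((k + n).choose (k - j) : ℝ) := by
  have hpow : (fun s : ℝ => Real.exp (-s) * s ^ ((k : ℝ) + n)) =
      fun s => Real.exp (-s) * s ^ (k + n) := by
    funext s
    rw [← Nat.cast_add, Real.rpow_natCast]
  have hexp (i : ℕ) : iteratedDeriv i (fun s : ℝ => Real.exp (-s)) τ =
      (-1) ^ i * Real.exp (-τ) := by
    simpa using congrFun (iteratedDeriv_exp_const_mul i (-1)) τ
  rw [laguerreL, hpow, iteratedDeriv_fun_mul (by fun_prop) (by fun_prop), Finset.mul_sum]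
  refine Finset.sum_congr rfl fun j hj => ?_
  have hjk : j ≤ k := Nat.lt_succ_iff.mp (Finset.mem_range.mp hj)
  have hchoose : (k.choose j : ℝ) * j.factorial * (k - j).factorial = k.factorial := by
    exact_mod_cast Nat.choose_mul_factorial_mul_factorial hjk
  have hdesc : ((k + n).descFactorial (k - j) : ℝ) =
      (k - j).factorial * (k + n).choose (k - j) := by
    exact_mod_cast Nat.descFactorial_eq_factorial_mul_choose _ _
  have hj0 : (j.factorial : ℝ) ≠ 0 := by positivity
  have hk0 : (k.factorial : ℝ) ≠ 0 := by positivity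
  rw [hexp, iteratedDeriv_pow, hdesc, show k + n - (k - j) = n + j by omega,
    Real.rpow_neg hτ.le, Real.rpow_natCast, Real.exp_neg, pow_add, neg_pow τ]
  field_simp
  linear_combination ((k + n).choose (k - j) : ℝ) * hchoose

theorem hasSum_exp_mul_choose_mul_geometric (n : ℕ) (τ : ℂ) {z : ℂ} (hz : ‖z‖ < 1) :
    Summable (fun p : ℕ × ℕ => ‖(-τ) ^ p.1 / (p.1.factorial : ℂ) *
      ((p.2 + (p.1 + n)).choose (p.1 + n) : ℂ) * z ^ (p.1 + p.2)‖) ∧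
    HasSum (fun p : ℕ × ℕ => (-τ) ^ p.1 / (p.1.factorial : ℂ) *
      ((p.2 + (p.1 + n)).choose (p.1 + n) : ℂ) * z ^ (p.1 + p.2))
      ((1 - z)⁻¹ ^ (n + 1) * Complex.exp (-τ * z / (1 - z))) := by
  have hrow (j : ℕ) : HasSum (fun m : ℕ => (-τ) ^ j / (j.factorial : ℂ) *
      ((m + (j + n)).choose (j + n) : ℂ) * z ^ (j + m))
      ((1 - z)⁻¹ ^ (n + 1) * ((-τ * z / (1 - z)) ^ j / (j.factorial : ℂ))) := by
    have h := (hasSum_choose_mul_geometric_of_norm_lt_one (j + n) hz).mul_left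
      ((-τ * z) ^ j / (j.factorial : ℂ))
    convert! h using 1
    · funext m
      rw [mul_pow, pow_add]
      ring
    · generalize 1 - z = w
      ring
  have hnorm (j : ℕ) : HasSum (fun m : ℕ => ‖(-τ) ^ j / (j.factorial : ℂ) *
      ((m + (j + n)).choose (j + n) : ℂ) * z ^ (j + m)‖)
      ((1 - ‖z‖)⁻¹ ^ (n + 1) * ((‖τ‖ * ‖z‖ / (1 - ‖z‖)) ^ j / (j.factorial : ℝ))) := by
    have h := (hasSum_choose_mul_geometric_of_norm_lt_one (𝕜 := ℝ) (j + n)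
      (r := ‖z‖) (by simpa using hz)).mul_left ((‖τ‖ * ‖z‖) ^ j / (j.factorial : ℝ))
    convert! h using 1
    · funext m
      simp only [norm_mul, norm_div, norm_pow, norm_neg, Complex.norm_natCast]
      rw [mul_pow, pow_add]
      ring
    · generalize 1 - ‖z‖ = w
      ring
  have hsum : Summable (fun p : ℕ × ℕ => ‖(-τ) ^ p.1 / (p.1.factorial : ℂ) *
      ((p.2 + (p.1 + n)).choose (p.1 + n) : ℂ) * z ^ (p.1 + p.2)‖) := by
    rw [summable_prod_of_nonneg fun p => norm_nonneg _]
    refine ⟨fun j => (hnorm j).summable, ?_⟩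
    simp_rw [fun j => (hnorm j).tsum_eq]
    exact (Real.summable_pow_div_factorial _).mul_left _
  refine ⟨hsum, ?_⟩
  have h := hsum.of_norm.hasSum.prod_fiberwise hrow
  have hexp := (NormedSpace.expSeries_div_hasSum_exp (-τ * z / (1 - z))).mul_left
    ((1 - z)⁻¹ ^ (n + 1))
  rw [← Complex.exp_eq_exp_ℂ] at hexp
  rw [← h.unique hexp]
  exact hsum.of_norm.hasSum

theorem sum_antidiagonal_laguerreL (k n : ℕ) {τ : ℝ} (hτ : 0 < τ) (z : ℂ) :
    ∑ p ∈ Finset.HasAntidiagonal.antidiagonal k, (-(τ : ℂ)) ^ p.1 / (p.1.factorial : ℂ) *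
      ((p.2 + (p.1 + n)).choose (p.1 + n) : ℂ) * z ^ (p.1 + p.2) =
    (laguerreL k n τ : ℂ) * z ^ k := by
  rw [laguerreL_natCast k n hτ, Finset.Nat.sum_antidiagonal_eq_sum_range_succ_mk]
  push_cast
  rw [Finset.sum_mul]
  refine Finset.sum_congr rfl fun j hj => ?_
  have hjk : j ≤ k := Nat.lt_succ_iff.mp (Finset.mem_range.mp hj)
  rw [show k - j + (j + n) = k + n by omega, show j + (k - j) = k by omega,
    ← Nat.choose_symm_of_eq_add (show k + n = (k - j) + (j + n) by omega)]

/-- The generating function of the Laguerre polynomials of natural type. -/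
theorem hasSum_laguerreL (n : ℕ) {τ : ℝ} (hτ : 0 < τ) {z : ℂ} (hz : ‖z‖ < 1) :
    HasSum (fun k => (laguerreL k n τ : ℂ) * z ^ k)
      ((1 - z)⁻¹ ^ (n + 1) * Complex.exp (-τ * z / (1 - z))) := by
  have h := (hasSum_exp_mul_choose_mul_geometric n τ hz).2
  rw [← Finset.HasAntidiagonal.sigmaAntidiagonalEquivProd.hasSum_iff] at h
  have h' := h.sigma fun k => hasSum_fintype _
  convert! h' using 1
  funext k
  rw [← sum_antidiagonal_laguerreL k n hτ z, ← Finset.sum_coe_sort]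
  rfl

theorem summable_norm_laguerreL (n : ℕ) {τ : ℝ} (hτ : 0 < τ) {z : ℂ} (hz : ‖z‖ < 1) :
    Summable (fun k => ‖(laguerreL k n τ : ℂ) * z ^ k‖) := by
  have h := (hasSum_exp_mul_choose_mul_geometric n τ hz).1
  rw [← Finset.HasAntidiagonal.sigmaAntidiagonalEquivProd.summable_iff] at h
  refine (h.sigma' fun k => (hasSum_fintype _).summable).of_nonneg_of_le
    (fun k => norm_nonneg _) fun k => ?_
  rw [← sum_antidiagonal_laguerreL k n hτ z, ← Finset.sum_coe_sort, tsum_fintype]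
  exact norm_sum_le _ _

theorem intervalIntegral_exp_int_mul (m : ℤ) :
    ∫ θ in (-Real.pi)..Real.pi, Complex.exp (m * θ * Complex.I) =
      if m = 0 then 2 * (Real.pi : ℂ) else 0 := by
  split_ifs with hm
  · simp [hm]
    ring
  · have hc : (m : ℂ) * Complex.I ≠ 0 := by simp [hm]
    have h := integral_exp_mul_complex (a := -Real.pi) (b := Real.pi) hc
    simp_rw [mul_right_comm _ _ Complex.I]
    rw [h, div_eq_zero_iff, sub_eq_zero]
    left
    refine Complex.exp_eq_exp_iff_exists_int.mpr ⟨m, ?_⟩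
    push_cast
    ring

/-- Cauchy's formula for the coefficients of an absolutely convergent power series. -/
theorem intervalIntegral_tsum_mul_exp {c : ℕ → ℂ} {r : ℝ} (hr : 0 ≤ r) {g : ℂ → ℂ}
    (hc : Summable fun n => ‖c n * (r : ℂ) ^ n‖)
    (hg : ∀ z : ℂ, ‖z‖ = r → HasSum (fun n => c n * z ^ n) (g z)) (k : ℕ) :
    ∫ θ in (-Real.pi)..Real.pi,
      g (r * Complex.exp (θ * Complex.I)) * Complex.exp (-(k * θ * Complex.I)) =
      2 * Real.pi * c k * r ^ k := by
  have hterm (n : ℕ) (θ : ℝ) :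
      c n * (r * Complex.exp (θ * Complex.I)) ^ n * Complex.exp (-(k * θ * Complex.I)) =
      c n * (r : ℂ) ^ n * Complex.exp (((n - k : ℤ) : ℂ) * θ * Complex.I) := by
    rw [mul_pow, ← Complex.exp_nat_mul, ← mul_assoc, mul_assoc, ← Complex.exp_add]
    congr 2
    push_cast
    ring
  have hsum : HasSum (fun n => ∫ θ in (-Real.pi)..Real.pi,
      c n * (r : ℂ) ^ n * Complex.exp (((n - k : ℤ) : ℂ) * θ * Complex.I))
      (∫ θ in (-Real.pi)..Real.pi,
        g (r * Complex.exp (θ * Complex.I)) * Complex.exp (-(k * θ * Complex.I))) := by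
    refine intervalIntegral.hasSum_integral_of_dominated_convergence
      (fun n _ => ‖c n * (r : ℂ) ^ n‖) (fun n => ?_) (fun n => ?_) ?_ ?_ ?_
    · exact Continuous.aestronglyMeasurable (by fun_prop)
    · refine ae_of_all _ fun θ _ => le_of_eq ?_
      rw [norm_mul, ← Complex.ofReal_intCast, ← Complex.ofReal_mul,
        Complex.norm_exp_ofReal_mul_I, mul_one]
    · exact ae_of_all _ fun _ _ => hc
    · exact intervalIntegrable_const
    · refine ae_of_all _ fun θ _ => ?_
      have hz : ‖(r : ℂ) * Complex.exp (θ * Complex.I)‖ = r := by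
        rw [norm_mul, Complex.norm_exp_ofReal_mul_I, mul_one, Complex.norm_of_nonneg hr]
      simpa only [hterm] using (hg _ hz).mul_right (Complex.exp (-(k * θ * Complex.I)))
  simp_rw [intervalIntegral.integral_const_mul, intervalIntegral_exp_int_mul] at hsum
  have hk := hasSum_single (f := fun n : ℕ => c n * (r : ℂ) ^ n *
    if (n - k : ℤ) = 0 then 2 * (Real.pi : ℂ) else 0) k fun n hn => by
      rw [if_neg (by omega), mul_zero]
  rw [hsum.unique hk]
  simp only [sub_self, if_true]
  ring

theorem one_sub_ne_zero_of_norm_lt_one {z : ℂ} (hz : ‖z‖ < 1) : 1 - z ≠ 0 := by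
  intro h
  rw [← sub_eq_zero.mp h, norm_one] at hz
  exact lt_irrefl _ hz

theorem le_re_one_add_div_one_sub {z : ℂ} (hz : ‖z‖ < 1) :
    (1 - ‖z‖ ^ 2) / 4 ≤ ((1 + z) / (1 - z)).re := by
  have hne : 0 < Complex.normSq (1 - z) :=
    Complex.normSq_pos.mpr (one_sub_ne_zero_of_norm_lt_one hz)
  have hle : Complex.normSq (1 - z) ≤ 4 := by
    rw [Complex.normSq_eq_norm_sq]
    have h1 : ‖1 - z‖ ≤ 2 := (norm_sub_le _ _).trans (by rw [norm_one]; linarith)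
    nlinarith [norm_nonneg (1 - z)]
  have hre : ((1 + z) / (1 - z)).re = (1 - ‖z‖ ^ 2) / Complex.normSq (1 - z) := by
    rw [Complex.div_re, ← add_div, ← Complex.normSq_eq_norm_sq, Complex.normSq_apply z]
    simp only [Complex.add_re, Complex.sub_re, Complex.add_im, Complex.sub_im, Complex.one_re,
      Complex.one_im]
    ring
  rw [hre]
  exact div_le_div_of_nonneg_left (by nlinarith [norm_nonneg z]) hne hle

theorem norm_integral_gaussian_le (d : ℕ) {a : ℝ} (ha : a ≠ 0) {w : ℂ} (hw : 0 < w.re)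
    (x y : Fin d → ℝ) :
    ‖∫ ξ : Fin d → ℝ, Complex.exp (Complex.I * (a / 2 * ∑ j, ξ j * (x j + y j) : ℝ)) *
      Complex.exp (-(|a| / 4 * ((∑ j, ξ j ^ 2) + ∑ j, (x j - y j) ^ 2) : ℝ) * w)‖ ≤
    (4 * Real.pi / (|a| * ‖w‖)) ^ ((d : ℝ) / 2) := by
  have ha' : 0 < |a| := abs_pos.mpr ha
  have hb : 0 < ((|a| / 4 : ℝ) * w : ℂ).re := by
    rw [Complex.re_ofReal_mul]
    positivity
  set c : Fin d → ℂ := fun j => Complex.I * (a / 2 * (x j + y j) : ℝ) with hc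
  have hfun (ξ : Fin d → ℝ) :
      Complex.exp (Complex.I * (a / 2 * ∑ j, ξ j * (x j + y j) : ℝ)) *
        Complex.exp (-(|a| / 4 * ((∑ j, ξ j ^ 2) + ∑ j, (x j - y j) ^ 2) : ℝ) * w) =
      Complex.exp (-(|a| / 4 * ∑ j, (x j - y j) ^ 2 : ℝ) * w) *
        Complex.exp (-((|a| / 4 : ℝ) * w) * ∑ j, (ξ j : ℂ) ^ 2 + ∑ j, c j * ξ j) := by
    rw [← Complex.exp_add, ← Complex.exp_add]
    congr 1
    have h1 : ∑ j, c j * ξ j = Complex.I * (a / 2 * ∑ j, ξ j * (x j + y j) : ℝ) := by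
      push_cast
      rw [Finset.mul_sum, Finset.mul_sum]
      refine Finset.sum_congr rfl fun j _ => ?_
      rw [hc]
      push_cast
      ring
    rw [h1]
    push_cast
    ring
  have hsq : ∑ j, c j ^ 2 = (-(a ^ 2 / 4 * ∑ j, (x j + y j) ^ 2 : ℝ) : ℂ) := by
    push_cast
    rw [Finset.mul_sum, ← Finset.sum_neg_distrib]
    refine Finset.sum_congr rfl fun j _ => ?_
    rw [hc]
    push_cast
    linear_combination (a / 2 * (x j + y j) : ℂ) ^ 2 * Complex.I_sq
  simp_rw [hfun]
  rw [integral_const_mul, GaussianFourier.integral_cexp_neg_mul_sum_add hb, norm_mul, norm_mul,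
    hsq, Fintype.card_fin]
  have h1 : ‖Complex.exp (-(|a| / 4 * ∑ j, (x j - y j) ^ 2 : ℝ) * w)‖ ≤ 1 := by
    rw [Complex.norm_exp, Real.exp_le_one_iff, neg_mul, Complex.neg_re, Complex.re_ofReal_mul]
    exact neg_nonpos.mpr (by positivity)
  have h2 : ‖Complex.exp ((-(a ^ 2 / 4 * ∑ j, (x j + y j) ^ 2 : ℝ) : ℂ) /
      (4 * ((|a| / 4 : ℝ) * w)))‖ ≤ 1 := by
    rw [Complex.norm_exp, Real.exp_le_one_iff, neg_div, Complex.neg_re, neg_nonpos,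
      div_eq_mul_inv, Complex.re_ofReal_mul]
    refine mul_nonneg (by positivity) ?_
    rw [Complex.inv_re]
    refine div_nonneg ?_ (Complex.normSq_nonneg _)
    have : (4 * ((|a| / 4 : ℝ) * w)).re = 4 * ((|a| / 4 : ℝ) * w).re := by simp
    rw [this]
    positivity
  have h3 : ‖((Real.pi : ℂ) / ((|a| / 4 : ℝ) * w)) ^ ((d : ℂ) / 2)‖ =
      (4 * Real.pi / (|a| * ‖w‖)) ^ ((d : ℝ) / 2) := by
    have : ((d : ℂ) / 2) = ((d / 2 : ℝ) : ℂ) := by push_cast; rfl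
    rw [this, Complex.norm_cpow_real, norm_div, norm_mul, Complex.norm_of_nonneg Real.pi_pos.le,
      Complex.norm_of_nonneg (by positivity)]
    congr 1
    field_simp
  rw [h3]
  have h4 : 0 ≤ (4 * Real.pi / (|a| * ‖w‖)) ^ ((d : ℝ) / 2) := by positivity
  calc _ ≤ 1 * ((4 * Real.pi / (|a| * ‖w‖)) ^ ((d : ℝ) / 2) * 1) := by gcongr
    _ = _ := by ring

/-- Cauchy's formula for the integrand of `projKernel`. -/
theorem intervalIntegral_laguerre_generating (n k : ℕ) {X r : ℝ} (hX : 0 < X) (hr : 0 ≤ r)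
    (hr1 : r < 1) :
    ∫ θ in (-Real.pi)..Real.pi,
      (1 - r * Complex.exp (θ * Complex.I))⁻¹ ^ (n + 1) *
        Complex.exp (-(X : ℂ) *
          ((1 + r * Complex.exp (θ * Complex.I)) / (1 - r * Complex.exp (θ * Complex.I)))) *
        Complex.exp (-(k * θ * Complex.I)) =
      2 * Real.pi * r ^ k * (laguerreL k n (2 * X) * Real.exp (-X) : ℝ) := by
  have hrn : ‖(r : ℂ)‖ = r := Complex.norm_of_nonneg hr
  have h := intervalIntegral_tsum_mul_exp hr
    (summable_norm_laguerreL n (mul_pos two_pos hX) (z := r) (by rwa [hrn]))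
    (fun z hz => hasSum_laguerreL n (mul_pos two_pos hX) (by rwa [hz])) k
  rw [Complex.ofReal_mul, mul_comm (laguerreL k n (2 * X) : ℂ), ← mul_assoc, mul_right_comm,
    mul_right_comm _ _ (laguerreL k n (2 * X) : ℂ), ← h, mul_comm,
    ← intervalIntegral.integral_const_mul]
  refine intervalIntegral.integral_congr fun θ _ => ?_
  have hz : 1 - (r : ℂ) * Complex.exp (θ * Complex.I) ≠ 0 := by
    refine one_sub_ne_zero_of_norm_lt_one ?_
    rwa [norm_mul, hrn, Complex.norm_exp_ofReal_mul_I, mul_one]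
  generalize (r : ℂ) * Complex.exp (θ * Complex.I) = z at hz
  have hexp : -(X : ℂ) * ((1 + z) / (1 - z)) = -((2 * X : ℝ) : ℂ) * z / (1 - z) + (-X : ℝ) := by
    push_cast
    field_simp
    ring
  rw [hexp, Complex.exp_add, Complex.ofReal_exp]
  ring

theorem abs_div_pi_le_norm_one_sub_mul_exp {ρ : ℝ} (hρ : 1 / 4 ≤ ρ) {φ : ℝ}
    (hφ : |φ| ≤ Real.pi) :
    |φ| / Real.pi ≤ ‖1 - (ρ : ℂ) * Complex.exp (φ * Complex.I)‖ := by
  have hsin : |φ| / Real.pi ≤ |Real.sin (φ / 2)| := by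
    have h := Real.mul_abs_le_abs_sin (x := φ / 2) (by rw [abs_div, abs_two]; linarith)
    rw [abs_div, abs_two] at h
    convert h using 1
    ring
  have hnorm : ‖1 - (ρ : ℂ) * Complex.exp (φ * Complex.I)‖ ^ 2 =
      (1 - ρ) ^ 2 + 4 * ρ * Real.sin (φ / 2) ^ 2 := by
    rw [← Complex.normSq_eq_norm_sq, Complex.exp_mul_I, ← Complex.ofReal_cos,
      ← Complex.ofReal_sin, Complex.normSq_apply]
    simp only [Complex.sub_re, Complex.sub_im, Complex.one_re, Complex.one_im,
      Complex.re_ofReal_mul, Complex.im_ofReal_mul, Complex.add_re, Complex.add_im,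
      Complex.ofReal_re, Complex.ofReal_im, Complex.I_re, Complex.I_im]
    rw [show φ = 2 * (φ / 2) by ring, Real.cos_two_mul, Real.sin_two_mul,
      show 2 * (φ / 2) / 2 = φ / 2 by ring]
    linear_combination (4 * ρ ^ 2 * Real.cos (φ / 2) ^ 2 - 4 * ρ) *
      Real.sin_sq_add_cos_sq (φ / 2)
  refine hsin.trans (abs_le_of_sq_le_sq ?_ (norm_nonneg _))
  rw [hnorm]
  nlinarith [sq_nonneg (1 - ρ), sq_nonneg (Real.sin (φ / 2))]

theorem intervalIntegrable_abs_div_pi_rpow :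
    IntervalIntegrable (fun φ : ℝ => (|φ| / Real.pi) ^ (-(1 / 2) : ℝ)) volume
      (-Real.pi) Real.pi := by
  have hpos : IntervalIntegrable (fun φ : ℝ => (|φ| / Real.pi) ^ (-(1 / 2) : ℝ)) volume
      0 Real.pi := by
    have h := (intervalIntegral.intervalIntegrable_rpow' (a := 0) (b := Real.pi)
      (show (-1 : ℝ) < -(1 / 2) by norm_num)).div_const (Real.pi ^ (-(1 / 2) : ℝ))
    refine h.congr fun φ hφ => ?_
    rw [Set.uIoc_of_le Real.pi_pos.le] at hφ
    rw [abs_of_pos hφ.1, Real.div_rpow hφ.1.le Real.pi_pos.le]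
  refine IntervalIntegrable.trans (b := 0) ?_ hpos
  rw [IntervalIntegrable.iff_comp_neg]
  simpa using hpos.symm

theorem exists_intervalIntegral_norm_one_sub_rpow_le :
    ∃ C > (0 : ℝ), ∀ ρ : ℝ, 1 / 4 ≤ ρ → ρ < 1 →
      ∫ θ in (-Real.pi)..Real.pi,
        ‖1 - (ρ : ℂ) * Complex.exp ((2 * θ : ℝ) * Complex.I)‖ ^ (-(1 / 2) : ℝ) ≤ C := by
  refine ⟨(∫ φ in (-Real.pi)..Real.pi, (|φ| / Real.pi) ^ (-(1 / 2) : ℝ)) + 1, ?_, ?_⟩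
  · have : 0 ≤ ∫ φ in (-Real.pi)..Real.pi, (|φ| / Real.pi) ^ (-(1 / 2) : ℝ) :=
      intervalIntegral.integral_nonneg (by linarith [Real.pi_pos]) fun φ _ => by positivity
    linarith
  intro ρ hρ hρ1
  set h : ℝ → ℝ := fun φ =>
    ‖1 - (ρ : ℂ) * Complex.exp (φ * Complex.I)‖ ^ (-(1 / 2) : ℝ) with hh
  have hper : Function.Periodic h (2 * Real.pi) := fun φ => by
    simp only [hh]
    push_cast
    rw [add_mul, Complex.exp_periodic]
  have hcont : Continuous h := by
    refine Continuous.rpow_const (by fun_prop) fun φ => Or.inl ?_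
    refine norm_ne_zero_iff.mpr (one_sub_ne_zero_of_norm_lt_one ?_)
    rwa [norm_mul, Complex.norm_exp_ofReal_mul_I, mul_one,
      Complex.norm_of_nonneg (by linarith)]
  have hintegrable (a b : ℝ) : IntervalIntegrable h volume a b := hcont.intervalIntegrable a b
  have hdouble : ∫ θ in (-Real.pi)..Real.pi, h (2 * θ) = ∫ φ in (-Real.pi)..Real.pi, h φ := by
    have h1 := hper.intervalIntegral_add_eq (-(2 * Real.pi)) (-Real.pi)
    have h2 := hper.intervalIntegral_add_eq 0 (-Real.pi)
    rw [show -(2 * Real.pi) + 2 * Real.pi = 0 by ring,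
      show -Real.pi + 2 * Real.pi = Real.pi by ring] at h1
    rw [zero_add, show -Real.pi + 2 * Real.pi = Real.pi by ring] at h2
    rw [intervalIntegral.integral_comp_mul_left h two_ne_zero, mul_neg,
      ← intervalIntegral.integral_add_adjacent_intervals (hintegrable _ 0) (hintegrable 0 _), h1, h2,
      smul_eq_mul]
    ring
  change ∫ θ in (-Real.pi)..Real.pi, h (2 * θ) ≤ _
  rw [hdouble]
  refine le_add_of_le_of_nonneg ?_ zero_le_one
  refine intervalIntegral.integral_mono_ae_restrict (by linarith [Real.pi_pos]) (hintegrable _ _)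
    intervalIntegrable_abs_div_pi_rpow ?_
  have hne : ∀ᵐ φ : ℝ ∂volume.restrict (Set.Icc (-Real.pi) Real.pi), φ ≠ 0 :=
    ae_restrict_of_ae (Measure.ae_ne volume 0)
  filter_upwards [hne, ae_restrict_mem measurableSet_Icc] with φ hφ0 hφ
  have hφ0' : 0 < |φ| := abs_pos.mpr hφ0
  exact Real.rpow_le_rpow_of_nonpos (by positivity)
    (abs_div_pi_le_norm_one_sub_mul_exp hρ (abs_le.mpr hφ)) (by norm_num)

theorem norm_inv_one_sub_pow_mul_rpow (d : ℕ) {P : ℝ} (hP : 0 ≤ P) {z : ℂ} (hz : ‖z‖ < 1) :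
    ‖(1 - z)⁻¹ ^ d‖ * (P / ‖(1 + z) / (1 - z)‖) ^ ((d : ℝ) / 2) =
      P ^ ((d : ℝ) / 2) * ‖1 - z ^ 2‖ ^ (-((d : ℝ) / 2)) := by
  have hA : 0 < ‖1 - z‖ := norm_pos_iff.mpr (one_sub_ne_zero_of_norm_lt_one hz)
  have hB : 0 < ‖1 + z‖ := by
    have := one_sub_ne_zero_of_norm_lt_one (z := -z) (by rwa [norm_neg])
    rw [sub_neg_eq_add] at this
    exact norm_pos_iff.mpr this
  have hpow : ‖(1 - z)⁻¹ ^ d‖ = ((‖1 - z‖⁻¹) ^ 2) ^ ((d : ℝ) / 2) := by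
    rw [norm_pow, norm_inv, ← Real.rpow_natCast _ 2, ← Real.rpow_mul (by positivity),
      ← Real.rpow_natCast]
    congr 1
    push_cast
    ring
  rw [hpow, ← Real.mul_rpow (by positivity) (by positivity), show 1 - z ^ 2 = (1 - z) * (1 + z) by
    ring, norm_mul, Real.rpow_neg (by positivity), ← Real.inv_rpow (by positivity),
    ← Real.mul_rpow hP (by positivity), norm_div]
  congr 1
  field_simp

theorem rpow_neg_half_le {s A : ℝ} (hs : 0 < s) (hsA : s ≤ A) (n : ℕ) :
    A ^ (-(((n + 1 : ℕ) : ℝ) / 2)) ≤ s ^ (-((n : ℝ) / 2)) * A ^ (-(1 / 2) : ℝ) := by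
  have hA : 0 < A := hs.trans_le hsA
  rw [show -(((n + 1 : ℕ) : ℝ) / 2) = -((n : ℝ) / 2) + -(1 / 2) by push_cast; ring,
    Real.rpow_add hA]
  gcongr ?_ * _
  exact Real.rpow_le_rpow_of_nonpos hs hsA (by linarith [(n.cast_nonneg : (0 : ℝ) ≤ n)])

/-- The integrand of `projKernel` with the Laguerre function replaced by its generating function. -/
noncomputable def mehlerIntegrand (d : ℕ) (a : ℝ) (x y : Fin d → ℝ) (z : ℂ) (ξ : Fin d → ℝ) : ℂ :=
  (1 - z)⁻¹ ^ d * (Complex.exp (Complex.I * (a / 2 * ∑ j, ξ j * (x j + y j) : ℝ)) *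
    Complex.exp (-(|a| / 4 * ((∑ j, ξ j ^ 2) + ∑ j, (x j - y j) ^ 2) : ℝ) *
      ((1 + z) / (1 - z))))

theorem norm_integral_mehlerIntegrand_le (d : ℕ) {a : ℝ} (ha : a ≠ 0) (x y : Fin d → ℝ) {z : ℂ}
    (hz : ‖z‖ < 1) :
    ‖∫ ξ, mehlerIntegrand d a x y z ξ‖ ≤
      (4 * Real.pi / |a|) ^ ((d : ℝ) / 2) * ‖1 - z ^ 2‖ ^ (-((d : ℝ) / 2)) := by
  have hw : 0 < ((1 + z) / (1 - z)).re :=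
    lt_of_lt_of_le (by nlinarith [norm_nonneg z]) (le_re_one_add_div_one_sub hz)
  simp only [mehlerIntegrand]
  rw [integral_const_mul, norm_mul, ← norm_inv_one_sub_pow_mul_rpow d (by positivity) hz, div_div]
  gcongr
  exact norm_integral_gaussian_le d ha hw x y

theorem norm_mehlerIntegrand_le (d : ℕ) (a : ℝ) (x y ξ : Fin d → ℝ) {z : ℂ} (hz : ‖z‖ < 1) :
    ‖mehlerIntegrand d a x y z ξ‖ ≤ (1 - ‖z‖)⁻¹ ^ d *
      ‖Complex.exp (-((|a| / 4 * ((1 - ‖z‖ ^ 2) / 4) : ℝ) : ℂ) * ∑ j, (ξ j : ℂ) ^ 2 +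
        ∑ j, (0 : Fin d → ℂ) j * ξ j)‖ := by
  have hle : 1 - ‖z‖ ≤ ‖1 - z‖ := by
    simpa using norm_sub_norm_le (1 : ℂ) z
  have hre := le_re_one_add_div_one_sub hz
  have hz2 : 0 ≤ (1 - ‖z‖ ^ 2) / 4 := by nlinarith [norm_nonneg z]
  have h0 : 0 < 1 - ‖z‖ := sub_pos.mpr hz
  rw [mehlerIntegrand, norm_mul, norm_mul, norm_pow, norm_inv, mul_comm Complex.I,
    Complex.norm_exp_ofReal_mul_I, one_mul]
  gcongr
  rw [Complex.norm_exp, Complex.norm_exp, Real.exp_le_exp, neg_mul, Complex.neg_re,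
    Complex.re_ofReal_mul]
  have hcast : (-((|a| / 4 * ((1 - ‖z‖ ^ 2) / 4) : ℝ) : ℂ) * ∑ j, (ξ j : ℂ) ^ 2 +
      ∑ j, (0 : Fin d → ℂ) j * ξ j) =
      ((-(|a| / 4 * ((1 - ‖z‖ ^ 2) / 4) * ∑ j, ξ j ^ 2) : ℝ) : ℂ) := by
    simp
  rw [hcast, Complex.ofReal_re, neg_le_neg_iff, mul_right_comm]
  have h1 : 0 ≤ ∑ j, ξ j ^ 2 := by positivity
  have h2 : 0 ≤ ∑ j, (x j - y j) ^ 2 := by positivity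
  gcongr
  linarith

theorem integrable_mehlerIntegrand_circle (d k : ℕ) {a : ℝ} (ha : a ≠ 0) (x y : Fin d → ℝ) {r : ℝ}
    (hr : 0 ≤ r) (hr1 : r < 1) :
    Integrable (Function.uncurry fun (θ : ℝ) (ξ : Fin d → ℝ) =>
      mehlerIntegrand d a x y (r * Complex.exp (θ * Complex.I)) ξ *
        Complex.exp (-(k * θ * Complex.I)))
      ((volume.restrict (Set.uIoc (-Real.pi) Real.pi)).prod volume) := by
  have hnorm (θ : ℝ) : ‖(r : ℂ) * Complex.exp (θ * Complex.I)‖ = r := by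
    rw [norm_mul, Complex.norm_exp_ofReal_mul_I, mul_one, Complex.norm_of_nonneg hr]
  have hne (θ : ℝ) : 1 - (r : ℂ) * Complex.exp (θ * Complex.I) ≠ 0 :=
    one_sub_ne_zero_of_norm_lt_one (by rwa [hnorm])
  have hb : 0 < ((|a| / 4 * ((1 - r ^ 2) / 4) : ℝ) : ℂ).re := by
    rw [Complex.ofReal_re]
    have := abs_pos.mpr ha
    have : 0 < 1 - r ^ 2 := by nlinarith
    positivity
  rw [Set.uIoc_of_le (by linarith [Real.pi_pos])]
  have hdom := (integrable_const ((1 - r)⁻¹ ^ d)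
    (μ := volume.restrict (Set.Ioc (-Real.pi) Real.pi))).mul_prod
    (GaussianFourier.integrable_cexp_neg_mul_sum_add hb (0 : Fin d → ℂ)).norm
  refine hdom.mono' (Continuous.aestronglyMeasurable ?_) (ae_of_all _ fun p => ?_)
  · have hinv : Continuous fun p : ℝ × (Fin d → ℝ) =>
        (1 - (r : ℂ) * Complex.exp (p.1 * Complex.I))⁻¹ :=
      Continuous.inv₀ (by fun_prop) fun p => hne p.1
    simp only [Function.uncurry_def, mehlerIntegrand, div_eq_mul_inv (1 + _ : ℂ)]
    fun_prop
  · have h := norm_mehlerIntegrand_le d a x y p.2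
      (z := (r : ℂ) * Complex.exp (p.1 * Complex.I)) (by rwa [hnorm])
    rw [hnorm] at h
    have h1 : ‖Complex.exp (-(k * p.1 * Complex.I))‖ = 1 := by
      rw [← neg_mul, ← Complex.ofReal_natCast, ← Complex.ofReal_mul, ← Complex.ofReal_neg,
        Complex.norm_exp_ofReal_mul_I]
    rw [Function.uncurry_def, norm_mul, h1, mul_one]
    exact h

/-- The kernel as a Fourier coefficient of the integral of the generating function. -/
theorem two_pi_mul_pow_mul_projKernel (n k : ℕ) {a : ℝ} (ha : a ≠ 0) (x y : Fin (n + 1) → ℝ)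
    {r : ℝ} (hr : 0 ≤ r) (hr1 : r < 1) :
    2 * Real.pi * r ^ k * projKernel (n + 1) k a x y =
      (((2 * Real.pi) ^ (-((n + 1 : ℕ) : ℝ)) * |a| ^ (n + 1) : ℝ) : ℂ) *
        ∫ θ in (-Real.pi)..Real.pi, (∫ ξ, mehlerIntegrand (n + 1) a x y
          (r * Complex.exp (θ * Complex.I)) ξ) * Complex.exp (-(k * θ * Complex.I)) := by
  simp_rw [← integral_mul_const]
  rw [intervalIntegral_integral_swap (integrable_mehlerIntegrand_circle (n + 1) k ha x y hr hr1),
    projKernel, mul_left_comm, ← integral_const_mul]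
  congr 1
  refine integral_congr_ae ?_
  filter_upwards [Measure.ae_ne volume (0 : Fin (n + 1) → ℝ)] with ξ hξ
  have hX : 0 < |a| / 4 * ((∑ j, ξ j ^ 2) + ∑ j, (x j - y j) ^ 2) := by
    have h1 : 0 < ∑ j, ξ j ^ 2 := by
      obtain ⟨i, hi⟩ := Function.ne_iff.mp hξ
      exact Finset.sum_pos' (fun j _ => sq_nonneg _)
        ⟨i, Finset.mem_univ i, sq_pos_iff.mpr hi⟩
    have h2 : 0 ≤ ∑ j, (x j - y j) ^ 2 := by positivity
    have := abs_pos.mpr ha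
    positivity
  have h := intervalIntegral_laguerre_generating n k hX hr hr1
  set X := |a| / 4 * ((∑ j, ξ j ^ 2) + ∑ j, (x j - y j) ^ 2) with hXdef
  have e1 : |a| / 2 * ((∑ j, ξ j ^ 2) + ∑ j, (x j - y j) ^ 2) = 2 * X := by rw [hXdef]; ring
  have e2 : -|a| / 4 * ((∑ j, ξ j ^ 2) + ∑ j, (x j - y j) ^ 2) = -X := by rw [hXdef]; ring
  have e3 : ((n + 1 : ℕ) : ℝ) - 1 = n := by push_cast; ring
  rw [e1, e2, e3, mul_left_comm, ← h, ← intervalIntegral.integral_const_mul]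
  refine intervalIntegral.integral_congr fun θ _ => ?_
  simp only [mehlerIntegrand, ← hXdef]
  ring

theorem proj_kernel_bound (d : ℕ) (hd : 1 ≤ d) :
    ∃ C > (0 : ℝ), ∀ (a : ℝ), a ≠ 0 → ∀ (k : ℕ) (x y : Fin d → ℝ),
      ‖projKernel d k a x y‖ ≤ C * |a| ^ ((d : ℝ) / 2) * (2 * (k : ℝ) + d) ^ (((d : ℝ) - 1) / 2) := by
  obtain ⟨n, rfl⟩ := Nat.exists_eq_succ_of_ne_zero (Nat.one_le_iff_ne_zero.mp hd)
  obtain ⟨C, hC, hCb⟩ := exists_intervalIntegral_norm_one_sub_rpow_le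
  refine ⟨(2 * Real.pi) ^ (-((n + 1 : ℕ) : ℝ)) * (4 * Real.pi) ^ (((n + 1 : ℕ) : ℝ) / 2) *
    2 ^ ((n : ℝ) / 2) * C, by positivity, fun a ha k x y => ?_⟩
  have ha' : 0 < |a| := abs_pos.mpr ha
  set N : ℝ := 2 * (k : ℝ) + (n + 1 : ℕ) with hN
  have hN1 : 1 ≤ N := by
    rw [hN]
    push_cast
    linarith [(k.cast_nonneg : (0 : ℝ) ≤ k), (n.cast_nonneg : (0 : ℝ) ≤ n)]
  set s : ℝ := (2 * N)⁻¹ with hs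
  have hs0 : 0 < s := by positivity
  have hs1 : s ≤ 1 / 2 := by
    rw [hs, one_div]
    exact inv_anti₀ two_pos (by linarith)
  have hpow : (1 : ℝ) / 2 ≤ (1 - s) ^ k := by
    have hbern := one_add_mul_le_pow (a := -s) (by linarith) k
    have hks : k * s ≤ 1 / 2 := by
      rw [hs, ← div_eq_mul_inv, div_le_iff₀ (by positivity), hN]
      push_cast
      linarith [(k.cast_nonneg : (0 : ℝ) ≤ k), (n.cast_nonneg : (0 : ℝ) ≤ n)]
    rw [← sub_eq_add_neg] at hbern
    linarith
  have hr0 : 0 ≤ 1 - s := by linarith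
  have hr1 : 1 - s < 1 := by linarith
  have hpt (θ : ℝ) : ‖(∫ ξ, mehlerIntegrand (n + 1) a x y
      ((1 - s : ℝ) * Complex.exp (θ * Complex.I)) ξ) * Complex.exp (-(k * θ * Complex.I))‖ ≤
      (4 * Real.pi / |a|) ^ (((n + 1 : ℕ) : ℝ) / 2) * s ^ (-((n : ℝ) / 2)) *
        ‖1 - (((1 - s) ^ 2 : ℝ) : ℂ) * Complex.exp ((2 * θ : ℝ) * Complex.I)‖ ^
          (-(1 / 2) : ℝ) := by
    have hz : ‖((1 - s : ℝ) : ℂ) * Complex.exp (θ * Complex.I)‖ = 1 - s := by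
      rw [norm_mul, Complex.norm_exp_ofReal_mul_I, mul_one, Complex.norm_of_nonneg hr0]
    have hzsq : (((1 - s : ℝ) : ℂ) * Complex.exp (θ * Complex.I)) ^ 2 =
        (((1 - s) ^ 2 : ℝ) : ℂ) * Complex.exp ((2 * θ : ℝ) * Complex.I) := by
      rw [mul_pow, ← Complex.exp_nat_mul]
      push_cast
      ring_nf
    have hphase : ‖Complex.exp (-(k * θ * Complex.I))‖ = 1 := by
      rw [← neg_mul, ← Complex.ofReal_natCast, ← Complex.ofReal_mul, ← Complex.ofReal_neg,
        Complex.norm_exp_ofReal_mul_I]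
    have hlow : s ≤ ‖1 - (((1 - s) ^ 2 : ℝ) : ℂ) * Complex.exp ((2 * θ : ℝ) * Complex.I)‖ := by
      have h := norm_sub_norm_le (1 : ℂ)
        ((((1 - s) ^ 2 : ℝ) : ℂ) * Complex.exp ((2 * θ : ℝ) * Complex.I))
      rw [norm_one, norm_mul, Complex.norm_exp_ofReal_mul_I, mul_one,
        Complex.norm_of_nonneg (by positivity)] at h
      nlinarith
    rw [norm_mul, hphase, mul_one, mul_assoc]
    refine (norm_integral_mehlerIntegrand_le (n + 1) ha x y (by rwa [hz])).trans ?_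
    rw [hzsq]
    gcongr
    exact rpow_neg_half_le hs0 hlow n
  have hintegrable : IntervalIntegrable (fun θ : ℝ =>
      (4 * Real.pi / |a|) ^ (((n + 1 : ℕ) : ℝ) / 2) * s ^ (-((n : ℝ) / 2)) *
        ‖1 - (((1 - s) ^ 2 : ℝ) : ℂ) * Complex.exp ((2 * θ : ℝ) * Complex.I)‖ ^
          (-(1 / 2) : ℝ)) volume (-Real.pi) Real.pi := by
    refine Continuous.intervalIntegrable (continuous_const.mul
      (Continuous.rpow_const (by fun_prop) fun θ => Or.inl ?_)) _ _
    refine norm_ne_zero_iff.mpr (one_sub_ne_zero_of_norm_lt_one ?_)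
    rw [norm_mul, Complex.norm_exp_ofReal_mul_I, mul_one, Complex.norm_of_nonneg (by positivity)]
    nlinarith
  have hbound := intervalIntegral.norm_integral_le_of_norm_le (by linarith [Real.pi_pos])
    (ae_of_all _ fun θ _ => hpt θ) hintegrable
  rw [intervalIntegral.integral_const_mul] at hbound
  replace hbound := hbound.trans (mul_le_mul_of_nonneg_left
    (hCb ((1 - s) ^ 2) (by nlinarith) (by nlinarith)) (by positivity))
  have hkernel := congrArg norm (two_pi_mul_pow_mul_projKernel n k ha x y hr0 hr1)
  have hcoef : ‖(2 * Real.pi * ((1 - s : ℝ) : ℂ) ^ k)‖ = 2 * Real.pi * (1 - s) ^ k := by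
    rw [← Complex.ofReal_pow, norm_mul, norm_mul, Complex.norm_of_nonneg Real.pi_pos.le,
      Complex.norm_of_nonneg (by positivity), Complex.norm_ofNat]
  rw [norm_mul, hcoef, norm_mul, Complex.norm_of_nonneg (by positivity)] at hkernel
  have hge : ‖projKernel (n + 1) k a x y‖ ≤
      2 * Real.pi * (1 - s) ^ k * ‖projKernel (n + 1) k a x y‖ :=
    le_mul_of_one_le_left (norm_nonneg _) (by nlinarith [Real.pi_gt_three])
  refine (hge.trans_eq hkernel).trans ((mul_le_mul_of_nonneg_left hbound
    (by positivity)).trans_eq ?_)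
  have hspow : s ^ (-((n : ℝ) / 2)) = 2 ^ ((n : ℝ) / 2) * N ^ ((n : ℝ) / 2) := by
    rw [hs, Real.inv_rpow (by positivity), Real.rpow_neg (by positivity), inv_inv,
      Real.mul_rpow zero_le_two (by linarith)]
  have hapow : |a| ^ (n + 1) = |a| ^ (((n + 1 : ℕ) : ℝ) / 2) * |a| ^ (((n + 1 : ℕ) : ℝ) / 2) := by
    rw [← Real.rpow_add ha', add_halves, Real.rpow_natCast]
  have hexp : (((n + 1 : ℕ) : ℝ) - 1) / 2 = (n : ℝ) / 2 := by push_cast; ring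
  have ha0 : |a| ^ (((n + 1 : ℕ) : ℝ) / 2) ≠ 0 := by positivity
  rw [Nat.succ_eq_add_one, hexp, hspow, hapow, Real.div_rpow (by positivity) ha'.le]
  field_simp
end

section
/- Let d₁, d₂ ≥ 1 and let f be a Schwartz function on ℝ^{d₁}×ℝ^{d₂}. Then for every μ > 0, the function 𝓟_μ f satisfies L(𝓟_μ f) = μ 𝓟_μ f, where L = −Δ_x − |x|²Δ_t is the Grushin operator. -/
open MeasureTheory
open scoped ENNReal

noncomputable section

/-- Physicists' Hermite polynomial. -/
def physHermite (k : ℕ) (τ : ℝ) : ℝ :=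
  (-1 : ℝ) ^ k * Real.exp (τ ^ 2) * iteratedDeriv k (fun s : ℝ => Real.exp (-s ^ 2)) τ

/-- Hermite function -/
def hermiteFun (k : ℕ) (τ : ℝ) : ℝ :=
  ((2 : ℝ) ^ k * (Nat.factorial k) * Real.sqrt Real.pi) ^ (-(1 : ℝ) / 2) *
    physHermite k τ * Real.exp (-τ ^ 2 / 2)

/-- multi-dim Hermite function -/
def hermiteFunMulti (d : ℕ) (ν : Fin d → ℕ) (x : Fin d → ℝ) : ℝ :=
  ∏ j, hermiteFun (ν j) (x j)

/-- scaled Hermite function Φ^a_ν -/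
def scaledHermite (d : ℕ) (a : ℝ) (ν : Fin d → ℕ) (x : Fin d → ℝ) : ℝ :=
  |a| ^ ((d : ℝ) / 4) * hermiteFunMulti d ν (fun j => Real.sqrt |a| * x j)

/-- spectral projection P_k(a) -/
def hermiteProj (d k : ℕ) (a : ℝ) (φ : (Fin d → ℝ) → ℂ) (x : Fin d → ℝ) : ℂ :=
  ∑ ν ∈ Finset.Nat.antidiagonalTuple d k,
    (∫ y : Fin d → ℝ, φ y * (scaledHermite d a ν y : ℂ)) * (scaledHermite d a ν x : ℂ)

/-- surface measure on unit sphere -/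
def sphereMeasure (n : ℕ) : Measure (Metric.sphere (0 : EuclideanSpace ℝ (Fin n)) 1) :=
  (volume : Measure (EuclideanSpace ℝ (Fin n))).toSphere

/-- inverse partial Fourier transform in t -/
def partialFT (d₁ d₂ : ℕ) (f : (Fin d₁ → ℝ) × (Fin d₂ → ℝ) → ℂ)
    (lam : Fin d₂ → ℝ) (x : Fin d₁ → ℝ) : ℂ :=
  ∫ t : Fin d₂ → ℝ, f (x, t) * Complex.exp (Complex.I * (∑ j, lam j * t j : ℝ))

/-- the restriction operator 𝓟_μ -/
def restOp (d₁ d₂ : ℕ) (μ : ℝ) (f : (Fin d₁ → ℝ) × (Fin d₂ → ℝ) → ℂ)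
    (x : Fin d₁ → ℝ) (t : Fin d₂ → ℝ) : ℂ :=
  (1 / (2 * Real.pi) : ℝ) * ∑' k : ℕ,
    ((μ ^ (d₂ - 1) / (2 * (k : ℝ) + d₁) ^ d₂ : ℝ) : ℂ) *
      ∫ ε : Metric.sphere (0 : EuclideanSpace ℝ (Fin d₂)) 1,
        hermiteProj d₁ k (μ / (2 * (k : ℝ) + d₁))
          (partialFT d₁ d₂ f (fun j => μ / (2 * (k : ℝ) + d₁) * (ε : EuclideanSpace ℝ (Fin d₂)) j)) x *
        Complex.exp (-Complex.I *
          (μ * (∑ j, t j * (ε : EuclideanSpace ℝ (Fin d₂)) j) / (2 * (k : ℝ) + d₁) : ℝ))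
        ∂(sphereMeasure d₂)

/-- L^p norm (extended) of an ℝ≥0∞-valued function -/
def lpNormENN {α : Type*} [MeasurableSpace α] (p : ℝ≥0∞) (g : α → ℝ≥0∞) (μ : Measure α) : ℝ≥0∞ :=
  if p = ∞ then essSup g μ
  else (∫⁻ a, g a ^ p.toReal ∂μ) ^ (1 / p.toReal)

/-- mixed norm ‖f‖_{L_x^q L_t^p} -/
def mixedNorm (d₁ d₂ : ℕ) (q p : ℝ≥0∞) (f : (Fin d₁ → ℝ) × (Fin d₂ → ℝ) → ℂ) : ℝ≥0∞ :=
  lpNormENN p (fun t => eLpNorm (fun x => f (x, t)) q volume) volume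

end

noncomputable section

/-- the Grushin operator L = -Δ_x - |x|²Δ_t -/
def grushinOp (d₁ d₂ : ℕ) (u : (Fin d₁ → ℝ) × (Fin d₂ → ℝ) → ℂ)
    (z : (Fin d₁ → ℝ) × (Fin d₂ → ℝ)) : ℂ :=
  -(∑ j : Fin d₁, fderiv ℝ (fun w => fderiv ℝ u w ((Pi.single j 1 : Fin d₁ → ℝ), 0)) z
      ((Pi.single j 1 : Fin d₁ → ℝ), 0)) -
    ((∑ i, z.1 i ^ 2 : ℝ) : ℂ) *
      ∑ k : Fin d₂, fderiv ℝ (fun w => fderiv ℝ u w ((0 : Fin d₁ → ℝ), Pi.single k 1)) z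
        ((0 : Fin d₁ → ℝ), Pi.single k 1)

end

section EigenfunctionAuxiliary

open Filter Topology Set
open scoped ContDiff

/-- Derivatives of the Gaussian `exp (-s ^ 2)`. -/
noncomputable def gaussDeriv (n : ℕ) : ℝ → ℝ := iteratedDeriv n (fun s : ℝ => Real.exp (-s ^ 2))

lemma gaussDeriv_hasDerivAt (n : ℕ) (x : ℝ) :
    HasDerivAt (gaussDeriv n) (gaussDeriv (n + 1) x) x := by
  have hs : ContDiff ℝ ∞ (fun s : ℝ => Real.exp (-s ^ 2)) := by fun_prop
  have hd : Differentiable ℝ (gaussDeriv n) :=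
    hs.differentiable_iteratedDeriv n (by exact_mod_cast WithTop.coe_lt_top n)
  rw [gaussDeriv, gaussDeriv, iteratedDeriv_succ]
  exact (hd x).hasDerivAt

lemma gaussDeriv_one (x : ℝ) : gaussDeriv 1 x = -2 * x * gaussDeriv 0 x := by
  have h : HasDerivAt (gaussDeriv 0) (-2 * x * gaussDeriv 0 x) x := by
    have h0 : gaussDeriv 0 = fun s : ℝ => Real.exp (-s ^ 2) := by
      simp [gaussDeriv]
    rw [h0]
    convert! ((hasDerivAt_pow 2 x).neg).exp using 1
    simp; ring
  exact (gaussDeriv_hasDerivAt 0 x).unique h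

lemma gaussDeriv_add_two (n : ℕ) (x : ℝ) :
    gaussDeriv (n + 2) x = -2 * x * gaussDeriv (n + 1) x - 2 * (n + 1) * gaussDeriv n x := by
  induction n generalizing x with
  | zero =>
    have h : HasDerivAt (gaussDeriv 1) (-2 * gaussDeriv 0 x + -2 * x * gaussDeriv 1 x) x := by
      have h1 : gaussDeriv 1 = fun y => -2 * y * gaussDeriv 0 y := funext gaussDeriv_one
      rw [h1]
      convert! ((hasDerivAt_id x).const_mul (-2)).mul (gaussDeriv_hasDerivAt 0 x) using 1
      simp [gaussDeriv_one]
    rw [(gaussDeriv_hasDerivAt 1 x).unique h]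
    simp; ring
  | succ n ih =>
    have h : HasDerivAt (gaussDeriv (n + 2))
        ((-2 * gaussDeriv (n + 1) x + -2 * x * gaussDeriv (n + 2) x) -
          2 * (n + 1) * gaussDeriv (n + 1) x) x := by
      have h1 : gaussDeriv (n + 2) = fun x =>
        -2 * x * gaussDeriv (n + 1) x - 2 * (n + 1) * gaussDeriv n x := funext ih
      rw [h1]
      convert! (((hasDerivAt_id x).const_mul (-2)).mul (gaussDeriv_hasDerivAt (n + 1) x)).sub
        ((gaussDeriv_hasDerivAt n x).const_mul (2 * ((n : ℝ) + 1))) using 1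
      simp [ih]
    rw [(gaussDeriv_hasDerivAt (n + 2) x).unique h]
    push_cast; ring

lemma gaussDeriv_eq_polynomial (n : ℕ) :
    ∃ p : Polynomial ℝ, ∀ x, gaussDeriv n x = p.eval x * Real.exp (-x ^ 2) := by
  induction n with
  | zero => exact ⟨1, fun x => by simp [gaussDeriv]⟩
  | succ n ih =>
    obtain ⟨p, hp⟩ := ih
    refine ⟨p.derivative - 2 * Polynomial.X * p, fun x => ?_⟩
    have h : HasDerivAt (gaussDeriv n)
        (p.derivative.eval x * Real.exp (-x ^ 2) +
          p.eval x * (Real.exp (-x ^ 2) * (-(2 * x)))) x := by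
      rw [show gaussDeriv n = fun x => p.eval x * Real.exp (-x ^ 2) from funext hp]
      convert! (p.hasDerivAt x).mul ((hasDerivAt_pow 2 x).neg).exp using 1
      simp
    rw [(gaussDeriv_hasDerivAt n x).unique h]
    simp; ring

/-- The normalising factor of `hermiteFun`, with the sign of the Rodrigues formula. -/
noncomputable def hermiteCoeff (n : ℕ) : ℝ :=
  ((2 : ℝ) ^ n * (Nat.factorial n) * Real.sqrt Real.pi) ^ (-(1 : ℝ) / 2) * (-1 : ℝ) ^ n

lemma hermiteCoeff_sq (n : ℕ) :
    hermiteCoeff n ^ 2 = ((2 : ℝ) ^ n * (Nat.factorial n) * Real.sqrt Real.pi)⁻¹ := by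
  have hpos : (0 : ℝ) ≤ (2 : ℝ) ^ n * (Nat.factorial n) * Real.sqrt Real.pi := by positivity
  rw [hermiteCoeff, mul_pow, ← pow_mul, mul_comm n 2, pow_mul]
  simp only [even_two, Even.neg_pow, one_pow, mul_one]
  rw [← Real.rpow_natCast, ← Real.rpow_mul hpos]
  norm_num
  rw [Real.rpow_neg_one]
  simp

lemma hermiteFun_eq (n : ℕ) (x : ℝ) :
    hermiteFun n x = hermiteCoeff n * (Real.exp (x ^ 2 / 2) * gaussDeriv n x) := by
  have h : Real.exp (x ^ 2) * Real.exp (-x ^ 2 / 2) = Real.exp (x ^ 2 / 2) := by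
    rw [← Real.exp_add]; ring_nf
  rw [hermiteFun, physHermite, hermiteCoeff, gaussDeriv, ← h]
  ring

/-- The derivative of a Hermite function. -/
noncomputable def hermiteFunDeriv (n : ℕ) (x : ℝ) : ℝ :=
  hermiteCoeff n * (Real.exp (x ^ 2 / 2) * (x * gaussDeriv n x + gaussDeriv (n + 1) x))

lemma hasDerivAt_exp_sq_half (x : ℝ) :
    HasDerivAt (fun x : ℝ => Real.exp (x ^ 2 / 2)) (Real.exp (x ^ 2 / 2) * x) x := by
  convert! ((hasDerivAt_pow 2 x).div_const 2).exp using 1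
  simp

lemma hermiteFun_hasDerivAt (n : ℕ) (x : ℝ) :
    HasDerivAt (hermiteFun n) (hermiteFunDeriv n x) x := by
  rw [show hermiteFun n = _ from funext (hermiteFun_eq n)]
  convert! ((hasDerivAt_exp_sq_half x).mul (gaussDeriv_hasDerivAt n x)).const_mul
    (hermiteCoeff n) using 1
  rw [hermiteFunDeriv]; ring

lemma hermiteFunDeriv_hasDerivAt (n : ℕ) (x : ℝ) :
    HasDerivAt (hermiteFunDeriv n) ((x ^ 2 - (2 * n + 1)) * hermiteFun n x) x := by
  rw [show hermiteFunDeriv n = fun x => _ from rfl]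
  convert! ((hasDerivAt_exp_sq_half x).mul (((hasDerivAt_id x).mul
    (gaussDeriv_hasDerivAt n x)).add (gaussDeriv_hasDerivAt (n + 1) x))).const_mul
    (hermiteCoeff n) using 1
  rw [hermiteFun_eq, gaussDeriv_add_two]
  simp; ring

lemma hermiteFun_contDiff (n : ℕ) : ContDiff ℝ ∞ (hermiteFun n) := by
  have hs : ContDiff ℝ ∞ (fun s : ℝ => Real.exp (-s ^ 2)) := by fun_prop
  have hg : ContDiff ℝ ∞ (gaussDeriv n) := by
    obtain ⟨p, hp⟩ := gaussDeriv_eq_polynomial n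
    rw [show gaussDeriv n = _ from funext hp]
    exact (Polynomial.contDiff_aeval p ∞).mul hs
  rw [show hermiteFun n = _ from funext (hermiteFun_eq n)]
  fun_prop

lemma hermiteFun_zero_sq (n : ℕ) : hermiteFun n 0 ^ 2 * Real.sqrt (n + 1) ≤ 1 := by
  induction n using Nat.twoStepInduction with
  | zero =>
    have h1 : (1 : ℝ) ≤ Real.sqrt Real.pi := Real.one_le_sqrt.2 (by linarith [Real.pi_gt_three])
    rw [hermiteFun_eq, mul_pow, hermiteCoeff_sq]
    simp [gaussDeriv]
    exact inv_le_one_of_one_le₀ h1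
  | one => simp [hermiteFun_eq, gaussDeriv_one]
  | more n ih _ =>
    have key : hermiteFun (n + 2) 0 ^ 2 = ((n : ℝ) + 1) / (n + 2) * hermiteFun n 0 ^ 2 := by
      rw [hermiteFun_eq, hermiteFun_eq, mul_pow, mul_pow (hermiteCoeff n), hermiteCoeff_sq,
        hermiteCoeff_sq, gaussDeriv_add_two, Nat.factorial_succ, Nat.factorial_succ]
      have : (0 : ℝ) < Real.sqrt Real.pi := by positivity
      push_cast
      field_simp
      simp
      ring
    have hle : Real.sqrt (((n + 2 : ℕ) : ℝ) + 1) * ((n : ℝ) + 1) ≤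
        Real.sqrt (n + 1) * (n + 2) := by
      apply (sq_le_sq₀ (by positivity) (by positivity)).1
      rw [mul_pow, mul_pow, Real.sq_sqrt (by positivity), Real.sq_sqrt (by positivity)]
      push_cast
      nlinarith [(Nat.cast_nonneg n : (0 : ℝ) ≤ n)]
    rw [key]
    calc _ = hermiteFun n 0 ^ 2 / (n + 2) * (Real.sqrt (((n + 2 : ℕ) : ℝ) + 1) * ((n : ℝ) + 1)) := by
          ring
      _ ≤ hermiteFun n 0 ^ 2 / (n + 2) * (Real.sqrt (n + 1) * (n + 2)) := by gcongr
      _ = hermiteFun n 0 ^ 2 * Real.sqrt (n + 1) := by field_simp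
      _ ≤ 1 := ih

lemma hermiteFunDeriv_zero_sq (n : ℕ) :
    hermiteFunDeriv n 0 ^ 2 = 2 * (n + 1) * hermiteFun (n + 1) 0 ^ 2 := by
  rw [hermiteFunDeriv, hermiteFun_eq, mul_pow, mul_pow (hermiteCoeff (n + 1)), hermiteCoeff_sq,
    hermiteCoeff_sq, Nat.factorial_succ]
  have : (0 : ℝ) < Real.sqrt Real.pi := by positivity
  push_cast
  field_simp
  simp
  ring

lemma hermite_energy_zero (n : ℕ) :
    hermiteFunDeriv n 0 ^ 2 + (2 * n + 1) * hermiteFun n 0 ^ 2 ≤ 4 * Real.sqrt (n + 1) := by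
  rw [hermiteFunDeriv_zero_sq]
  have h0 := hermiteFun_zero_sq n
  have h1 := hermiteFun_zero_sq (n + 1)
  push_cast at h1
  have hs : Real.sqrt (n + 1) ≤ Real.sqrt ((n : ℝ) + 1 + 1) := Real.sqrt_le_sqrt (by linarith)
  have hp : 0 < Real.sqrt ((n : ℝ) + 1) := by positivity
  have hq : Real.sqrt ((n : ℝ) + 1) ^ 2 = n + 1 := Real.sq_sqrt (by positivity)
  set s := Real.sqrt ((n : ℝ) + 1)
  have h2 : hermiteFun (n + 1) 0 ^ 2 * s ≤ 1 := by
    refine le_trans ?_ h1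
    gcongr
  have e1 : ((n : ℝ) + 1) = s ^ 2 := hq.symm
  have e2 : 2 * (n : ℝ) + 1 ≤ 2 * s ^ 2 := by linarith
  calc _ ≤ 2 * s ^ 2 * hermiteFun (n + 1) 0 ^ 2 + 2 * s ^ 2 * hermiteFun n 0 ^ 2 := by
        rw [e1]; gcongr
    _ = 2 * s * (hermiteFun (n + 1) 0 ^ 2 * s) + 2 * s * (hermiteFun n 0 ^ 2 * s) := by ring
    _ ≤ 2 * s * 1 + 2 * s * 1 := by gcongr
    _ = _ := by ring

lemma hermiteFun_mul_deriv_tendsto (n : ℕ) :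
    Tendsto (fun x => hermiteFun n x * hermiteFunDeriv n x) atTop (𝓝 0) := by
  obtain ⟨p, hp⟩ := gaussDeriv_eq_polynomial n
  obtain ⟨q, hq⟩ := gaussDeriv_eq_polynomial (n + 1)
  set r : Polynomial ℝ := Polynomial.C (hermiteCoeff n ^ 2) * (p * (Polynomial.X * p + q)) with hr
  have h : ∀ x, hermiteFun n x * hermiteFunDeriv n x = r.eval x * Real.exp (-x ^ 2) := by
    intro x
    have he : Real.exp (x ^ 2 / 2) * Real.exp (x ^ 2 / 2) * Real.exp (-x ^ 2) = 1 := by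
      rw [← Real.exp_add, ← Real.exp_add, Real.exp_eq_one_iff]; ring
    rw [hermiteFun_eq, hermiteFunDeriv, hp, hq, hr]
    simp only [Polynomial.eval_mul, Polynomial.eval_add, Polynomial.eval_C, Polynomial.eval_X]
    linear_combination (hermiteCoeff n ^ 2 * (p.eval x * (x * p.eval x + q.eval x)) *
      Real.exp (-x ^ 2)) * he
  refine squeeze_zero_norm' ?_ ((Polynomial.tendsto_div_exp_atTop r).norm.trans (by simp))
  filter_upwards [eventually_ge_atTop 1] with x hx
  rw [h, norm_mul, norm_div, div_eq_mul_inv]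
  gcongr
  rw [Real.norm_of_nonneg (Real.exp_nonneg _), Real.norm_of_nonneg (Real.exp_nonneg _),
    ← Real.exp_neg, Real.exp_le_exp]
  nlinarith

section Energy

variable {φ ψ : ℝ → ℝ} {m : ℝ}

lemma energy_le (hφ : ∀ x, HasDerivAt φ (ψ x) x)
    (hψ : ∀ x, HasDerivAt ψ ((x ^ 2 - m) * φ x) x) {x : ℝ} (hx : 0 ≤ x) :
    ψ x ^ 2 + (m - x ^ 2) * φ x ^ 2 ≤ ψ 0 ^ 2 + m * φ 0 ^ 2 := by
  have hd : ∀ y, HasDerivAt (fun y => ψ y ^ 2 + (m - y ^ 2) * φ y ^ 2) (-2 * y * φ y ^ 2) y := by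
    intro y
    convert! ((hψ y).pow 2).add ((((hasDerivAt_const y m).sub (hasDerivAt_pow 2 y))).mul
      ((hφ y).pow 2)) using 1
    simp; ring
  have hanti : AntitoneOn (fun y => ψ y ^ 2 + (m - y ^ 2) * φ y ^ 2) (Ici 0) := by
    refine antitoneOn_of_hasDerivWithinAt_nonpos (convex_Ici 0)
      (fun y _ => (hd y).continuousAt.continuousWithinAt)
      (fun y _ => (hd y).hasDerivWithinAt) (fun y hy => ?_)
    rw [interior_Ici] at hy
    have : (0 : ℝ) < y := hy
    nlinarith [sq_nonneg (φ y)]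
  have h := hanti (mem_Ici.2 le_rfl) (mem_Ici.2 hx) hx
  simpa using h

lemma sq_le_of_le_turning (hm : 1 ≤ m) (hφ : ∀ x, HasDerivAt φ (ψ x) x)
    (hψ : ∀ x, HasDerivAt ψ ((x ^ 2 - m) * φ x) x) {x : ℝ} (hx : 0 ≤ x) (hxm : x ^ 2 ≤ m) :
    φ x ^ 2 ≤ 4 * m * (ψ 0 ^ 2 + m * φ 0 ^ 2) := by
  set E := ψ 0 ^ 2 + m * φ 0 ^ 2 with hE
  have hE0 : 0 ≤ E := by positivity
  have hb : ∀ y ∈ Icc 0 x, ‖ψ y‖ ≤ Real.sqrt E := by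
    intro y hy
    apply Real.abs_le_sqrt
    have h := energy_le hφ hψ hy.1
    have : 0 ≤ m - y ^ 2 := by nlinarith [hy.1, hy.2]
    nlinarith [mul_nonneg this (sq_nonneg (φ y))]
  have hmv := (convex_Icc 0 x).norm_image_sub_le_of_norm_hasDerivWithin_le
    (fun y _ => (hφ y).hasDerivWithinAt) hb (left_mem_Icc.2 hx) (right_mem_Icc.2 hx)
  rw [Real.norm_eq_abs, Real.norm_eq_abs, sub_zero, abs_of_nonneg hx] at hmv
  have h1 : (φ x - φ 0) ^ 2 ≤ E * m := by
    rw [← sq_abs]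
    calc |φ x - φ 0| ^ 2 ≤ (Real.sqrt E * x) ^ 2 := by gcongr
      _ = E * x ^ 2 := by rw [mul_pow, Real.sq_sqrt hE0]
      _ ≤ E * m := by gcongr
  have h2 : φ 0 ^ 2 ≤ E := by nlinarith [sq_nonneg (φ 0), sq_nonneg (ψ 0)]
  nlinarith [sq_nonneg (φ x - 2 * φ 0)]

lemma sq_le_of_turning_le (hφ : ∀ x, HasDerivAt φ (ψ x) x)
    (hψ : ∀ x, HasDerivAt ψ ((x ^ 2 - m) * φ x) x)
    (hlim : Tendsto (fun x => φ x * ψ x) atTop (𝓝 0)) {x₀ x : ℝ} (h0 : 0 ≤ x₀)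
    (hm : m ≤ x₀ ^ 2) (hx : x₀ ≤ x) : φ x ^ 2 ≤ φ x₀ ^ 2 := by
  have hd : ∀ y, HasDerivAt (fun y => φ y * ψ y) (ψ y ^ 2 + (y ^ 2 - m) * φ y ^ 2) y := by
    intro y
    convert! (hφ y).mul (hψ y) using 1
    ring
  have hmono : MonotoneOn (fun y => φ y * ψ y) (Ici x₀) := by
    refine monotoneOn_of_hasDerivWithinAt_nonneg (convex_Ici x₀)
      (fun y _ => (hd y).continuousAt.continuousWithinAt)
      (fun y _ => (hd y).hasDerivWithinAt) (fun y hy => ?_)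
    rw [interior_Ici] at hy
    have h1 : x₀ < y := hy
    have : 0 ≤ y ^ 2 - m := by nlinarith
    positivity
  have hneg : ∀ y ∈ Ici x₀, φ y * ψ y ≤ 0 := by
    intro y hy
    refine ge_of_tendsto hlim ?_
    filter_upwards [eventually_ge_atTop y] with z hz
    exact hmono hy (le_trans hy hz) hz
  have hanti : AntitoneOn (fun y => φ y ^ 2) (Ici x₀) := by
    refine antitoneOn_of_hasDerivWithinAt_nonpos (convex_Ici x₀)
      (fun y _ => (hφ y).continuousAt.continuousWithinAt.pow 2)
      (fun y _ => ((hφ y).pow 2).hasDerivWithinAt) (fun y hy => ?_)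
    rw [interior_Ici] at hy
    have := hneg y (mem_Ici.2 (mem_Ioi.1 hy).le)
    simp only [Nat.cast_ofNat, Nat.add_one_sub_one, pow_one]
    nlinarith
  exact hanti (mem_Ici.2 le_rfl) hx hx

lemma sq_le_weight (hm : 1 ≤ m) (hφ : ∀ x, HasDerivAt φ (ψ x) x)
    (hψ : ∀ x, HasDerivAt ψ ((x ^ 2 - m) * φ x) x)
    (hlim : Tendsto (fun x => φ x * ψ x) atTop (𝓝 0)) {x : ℝ} (hx : 0 ≤ x) :
    m * φ x ^ 2 ≤ (ψ 0 ^ 2 + m * φ 0 ^ 2) * (2 + 16 * x ^ 4) := by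
  set E := ψ 0 ^ 2 + m * φ 0 ^ 2 with hE
  have hE0 : 0 ≤ E := by positivity
  by_cases h : x ^ 2 ≤ m / 2
  · have h1 := energy_le hφ hψ hx
    rw [← hE] at h1
    have h2 : 0 ≤ m / 2 - x ^ 2 := by linarith
    have h3 : m * φ x ^ 2 ≤ 2 * E := by
      nlinarith [mul_nonneg h2 (sq_nonneg (φ x)), sq_nonneg (ψ x)]
    have : 0 ≤ E * (16 * x ^ 4) := by positivity
    linarith
  · push Not at h
    have hmx : m ^ 2 ≤ 4 * x ^ 4 := by
      have : m ≤ 2 * x ^ 2 := by linarith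
      calc m ^ 2 ≤ (2 * x ^ 2) ^ 2 := by gcongr
        _ = _ := by ring
    have hb : φ x ^ 2 ≤ 4 * m * E := by
      by_cases h' : x ^ 2 ≤ m
      · exact sq_le_of_le_turning hm hφ hψ hx h'
      · push Not at h'
        have hs : Real.sqrt m ^ 2 = m := Real.sq_sqrt (by linarith)
        refine (sq_le_of_turning_le hφ hψ hlim (Real.sqrt_nonneg m) hs.ge ?_).trans
          (sq_le_of_le_turning hm hφ hψ (Real.sqrt_nonneg m) hs.le)
        exact (Real.sqrt_le_left hx).2 h'.le
    calc m * φ x ^ 2 ≤ m * (4 * m * E) := by gcongr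
      _ = 4 * E * m ^ 2 := by ring
      _ ≤ 4 * E * (4 * x ^ 4) := by gcongr
      _ ≤ _ := by nlinarith

lemma deriv_sq_le_weight (hm : 1 ≤ m) (hφ : ∀ x, HasDerivAt φ (ψ x) x)
    (hψ : ∀ x, HasDerivAt ψ ((x ^ 2 - m) * φ x) x)
    (hlim : Tendsto (fun x => φ x * ψ x) atTop (𝓝 0)) {x : ℝ} (hx : 0 ≤ x) :
    ψ x ^ 2 ≤ (ψ 0 ^ 2 + m * φ 0 ^ 2) * (1 + x ^ 2 * (2 + 16 * x ^ 4)) := by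
  have h1 := energy_le hφ hψ hx
  have h2 := sq_le_weight hm hφ hψ hlim hx
  have h3 : φ x ^ 2 ≤ m * φ x ^ 2 := by nlinarith [sq_nonneg (φ x)]
  nlinarith [mul_le_mul_of_nonneg_left (h3.trans h2) (sq_nonneg x), mul_nonneg (sub_nonneg.2 hm) (sq_nonneg (φ x))]

end Energy

lemma gaussDeriv_neg (n : ℕ) (x : ℝ) : gaussDeriv n (-x) = (-1) ^ n * gaussDeriv n x := by
  induction n using Nat.twoStepInduction generalizing x with
  | zero => simp [gaussDeriv]
  | one => rw [gaussDeriv_one, gaussDeriv_one]; simp [gaussDeriv]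
  | more n ih1 ih2 => rw [gaussDeriv_add_two, gaussDeriv_add_two, ih1, ih2]; ring

lemma hermiteFun_neg (n : ℕ) (x : ℝ) : hermiteFun n (-x) = (-1) ^ n * hermiteFun n x := by
  rw [hermiteFun_eq, hermiteFun_eq, gaussDeriv_neg]; simp; ring

lemma hermiteFunDeriv_neg (n : ℕ) (x : ℝ) :
    hermiteFunDeriv n (-x) = (-1) ^ (n + 1) * hermiteFunDeriv n x := by
  rw [hermiteFunDeriv, hermiteFunDeriv, gaussDeriv_neg, gaussDeriv_neg]; simp; ring

lemma hermiteFun_sq_abs (n : ℕ) (x : ℝ) : hermiteFun n |x| ^ 2 = hermiteFun n x ^ 2 := by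
  rcases abs_choice x with h | h <;> rw [h]
  rw [hermiteFun_neg, mul_pow, ← pow_mul, mul_comm n 2, pow_mul]; simp

lemma hermiteFunDeriv_sq_abs (n : ℕ) (x : ℝ) :
    hermiteFunDeriv n |x| ^ 2 = hermiteFunDeriv n x ^ 2 := by
  rcases abs_choice x with h | h <;> rw [h]
  rw [hermiteFunDeriv_neg, mul_pow, ← pow_mul, mul_comm (n + 1) 2, pow_mul]; simp

/-- The decay rate `(n + 1) ^ (-1/4)` of the Hermite functions on compact sets. -/
noncomputable def hermiteRate (n : ℕ) : ℝ := (Real.sqrt (Real.sqrt (n + 1)))⁻¹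

lemma hermiteRate_pos (n : ℕ) : 0 < hermiteRate n := by
  unfold hermiteRate; positivity

lemma hermiteRate_sq (n : ℕ) : hermiteRate n ^ 2 = (Real.sqrt (n + 1))⁻¹ := by
  rw [hermiteRate, inv_pow, Real.sq_sqrt (by positivity)]

lemma abs_hermiteFun_le (n : ℕ) (x : ℝ) :
    |hermiteFun n x| ≤ 8 * (1 + x ^ 2) * hermiteRate n := by
  have hr := hermiteRate_pos n
  apply abs_le_of_sq_le_sq _ (by positivity)
  have h := sq_le_weight (m := 2 * n + 1) (by linarith [(Nat.cast_nonneg n : (0 : ℝ) ≤ n)])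
    (hermiteFun_hasDerivAt n) (hermiteFunDeriv_hasDerivAt n) (hermiteFun_mul_deriv_tendsto n)
    (abs_nonneg x)
  rw [hermiteFun_sq_abs, show |x| ^ 4 = (x ^ 2) ^ 2 by rw [← sq_abs x]; ring] at h
  have hE := hermite_energy_zero n
  have hs : 0 < Real.sqrt ((n : ℝ) + 1) := by positivity
  have hq : Real.sqrt ((n : ℝ) + 1) ^ 2 = n + 1 := Real.sq_sqrt (by positivity)
  rw [mul_pow, hermiteRate_sq, ← div_eq_mul_inv, le_div_iff₀ hs]
  set s := Real.sqrt ((n : ℝ) + 1)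
  have hw : 0 ≤ 2 + 16 * (x ^ 2) ^ 2 := by positivity
  have h1 : s * (hermiteFun n x ^ 2 * s) ≤ s * (4 * (2 + 16 * (x ^ 2) ^ 2)) := by
    calc s * (hermiteFun n x ^ 2 * s) = (n + 1) * hermiteFun n x ^ 2 := by rw [← hq]; ring
      _ ≤ (2 * n + 1) * hermiteFun n x ^ 2 := by gcongr; linarith [(Nat.cast_nonneg n : (0 : ℝ) ≤ n)]
      _ ≤ _ := h
      _ ≤ 4 * s * (2 + 16 * (x ^ 2) ^ 2) := by gcongr
      _ = _ := by ring
  have h2 := le_of_mul_le_mul_left h1 hs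
  nlinarith [sq_nonneg x]

lemma abs_hermiteFunDeriv_le (n : ℕ) (x : ℝ) :
    |hermiteFunDeriv n x| ≤ 8 * (1 + x ^ 2) ^ 2 * (Real.sqrt (n + 1) * hermiteRate n) := by
  have hr := hermiteRate_pos n
  apply abs_le_of_sq_le_sq _ (by positivity)
  have h := deriv_sq_le_weight (m := 2 * n + 1) (by linarith [(Nat.cast_nonneg n : (0 : ℝ) ≤ n)])
    (hermiteFun_hasDerivAt n) (hermiteFunDeriv_hasDerivAt n) (hermiteFun_mul_deriv_tendsto n)
    (abs_nonneg x)
  rw [hermiteFunDeriv_sq_abs, show |x| ^ 4 = (x ^ 2) ^ 2 by rw [← sq_abs x]; ring, sq_abs] at h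
  have hE := hermite_energy_zero n
  have hs : 0 < Real.sqrt ((n : ℝ) + 1) := by positivity
  rw [mul_pow, mul_pow (Real.sqrt _), hermiteRate_sq]
  set s := Real.sqrt ((n : ℝ) + 1)
  set y := x ^ 2 with hy
  have hy0 : 0 ≤ y := by positivity
  calc hermiteFunDeriv n x ^ 2 ≤ _ := h
    _ ≤ 4 * s * (1 + y * (2 + 16 * y ^ 2)) := by gcongr
    _ = 4 * (1 + y * (2 + 16 * y ^ 2)) * s := by ring
    _ ≤ (8 * (1 + y) ^ 2) ^ 2 * s := by
        gcongr
        nlinarith [pow_nonneg hy0 2, pow_nonneg hy0 3, pow_nonneg hy0 4]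
    _ = _ := by field_simp

lemma abs_hermiteFun_second_le (n : ℕ) (x : ℝ) :
    |(x ^ 2 - (2 * n + 1)) * hermiteFun n x| ≤
      16 * (1 + x ^ 2) ^ 2 * (Real.sqrt (n + 1) ^ 2 * hermiteRate n) := by
  have hr := hermiteRate_pos n
  have hn : (0 : ℝ) ≤ n := Nat.cast_nonneg n
  have h1 : |x ^ 2 - (2 * n + 1)| ≤ 2 * (1 + x ^ 2) * (n + 1) := by
    rw [abs_le]; constructor <;> nlinarith [sq_nonneg x, mul_nonneg (sq_nonneg x) hn]
  rw [abs_mul, Real.sq_sqrt (by positivity)]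
  calc _ ≤ (2 * (1 + x ^ 2) * (n + 1)) * (8 * (1 + x ^ 2) * hermiteRate n) := by
        gcongr; exact abs_hermiteFun_le n x
    _ = _ := by ring

section C2Bound

variable {E E' F : Type*} [NormedAddCommGroup E] [NormedSpace ℝ E] [NormedAddCommGroup E']
  [NormedSpace ℝ E'] [NormedAddCommGroup F] [NormedSpace ℝ F]

/-- `g` is twice continuously differentiable, and its derivatives of order at most two are bounded
by `M` on `s`. -/
def HasC2Bound (s : Set E) (g : E → F) (M : ℝ) : Prop :=
  ContDiff ℝ 2 g ∧ ∀ i ≤ 2, ∀ w ∈ s, ‖iteratedFDeriv ℝ i g w‖ ≤ M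

lemma HasC2Bound.mono {s : Set E} {g : E → F} {M N : ℝ} (h : HasC2Bound s g M) (hMN : M ≤ N) :
    HasC2Bound s g N :=
  ⟨h.1, fun i hi w hw => (h.2 i hi w hw).trans hMN⟩

lemma HasC2Bound.const_smul {s : Set E} {g : E → ℂ} {M : ℝ} (h : HasC2Bound s g M) (c : ℂ) :
    HasC2Bound s (fun w => c * g w) (‖c‖ * M) := by
  refine ⟨contDiff_const.mul h.1, fun i hi w hw => ?_⟩
  have hc : ContDiffAt ℝ i g w := (h.1.of_le (by exact_mod_cast hi)).contDiffAt
  have h1 : iteratedFDeriv ℝ i (fun w => c * g w) w = c • iteratedFDeriv ℝ i g w :=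
    iteratedFDeriv_const_smul_apply' (a := c) hc
  rw [h1, norm_smul]
  gcongr
  exact h.2 i hi w hw

lemma HasC2Bound.sum {ι : Type*} {s : Set E} (u : Finset ι) {g : ι → E → F} {M : ι → ℝ}
    (h : ∀ j ∈ u, HasC2Bound s (g j) (M j)) :
    HasC2Bound s (fun w => ∑ j ∈ u, g j w) (∑ j ∈ u, M j) := by
  refine ⟨ContDiff.sum fun j hj => (h j hj).1, fun i hi w hw => ?_⟩
  rw [iteratedFDeriv_fun_sum_apply
    (fun j hj => ((h j hj).1.of_le (by exact_mod_cast hi)).contDiffAt)]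
  exact (norm_sum_le _ _).trans (Finset.sum_le_sum fun j hj => (h j hj).2 i hi w hw)

lemma HasC2Bound.mul {s : Set E} {f g : E → ℂ} {M N : ℝ} (hf : HasC2Bound s f M)
    (hg : HasC2Bound s g N) : HasC2Bound s (fun w => f w * g w) (4 * (M * N)) := by
  refine ⟨hf.1.mul hg.1, fun i hi w hw => ?_⟩
  have hM : 0 ≤ M := (norm_nonneg _).trans (hf.2 0 (by norm_num) w hw)
  have hN : 0 ≤ N := (norm_nonneg _).trans (hg.2 0 (by norm_num) w hw)
  refine (norm_iteratedFDeriv_mul_le hf.1 hg.1 w (n := i) (by exact_mod_cast hi)).trans ?_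
  calc _ ≤ ∑ j ∈ Finset.range (i + 1), (i.choose j : ℝ) * (M * N) := by
        refine Finset.sum_le_sum fun j hj => ?_
        rw [mul_assoc]
        have hj' : j ≤ i := Nat.lt_succ_iff.1 (Finset.mem_range.1 hj)
        gcongr
        · exact hf.2 j (hj'.trans hi) w hw
        · exact hg.2 (i - j) ((Nat.sub_le _ _).trans hi) w hw
    _ = 2 ^ i * (M * N) := by
        rw [← Finset.sum_mul, ← Nat.cast_sum, Nat.sum_range_choose]; push_cast; rfl
    _ ≤ 2 ^ 2 * (M * N) := by gcongr; norm_num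
    _ = _ := by norm_num

lemma HasC2Bound.one (s : Set E) : HasC2Bound s (fun _ => (1 : ℂ)) 1 := by
  refine ⟨contDiff_const, fun i _ w _ => ?_⟩
  rcases Nat.eq_zero_or_pos i with rfl | hi
  · simp
  · rw [iteratedFDeriv_const_of_ne hi.ne']; simp

lemma HasC2Bound.prod {ι : Type*} {s : Set E} (u : Finset ι) {g : ι → E → ℂ} {M : ι → ℝ}
    (h : ∀ j ∈ u, HasC2Bound s (g j) (M j)) :
    HasC2Bound s (fun w => ∏ j ∈ u, g j w) (∏ j ∈ u, (4 * M j)) := by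
  classical
  induction u using Finset.induction_on with
  | empty => simpa using HasC2Bound.one s
  | insert a u ha ih =>
    simp only [Finset.prod_insert ha]
    rw [mul_assoc]
    exact (h a (Finset.mem_insert_self a u)).mul
      (ih fun j hj => h j (Finset.mem_insert_of_mem hj))

lemma HasC2Bound.comp_clm {s : Set E'} {g : E' → F} {M : ℝ} (hg : HasC2Bound s g M)
    (L : E →L[ℝ] E') (hL : ‖L‖ ≤ 1) : HasC2Bound (L ⁻¹' s) (fun w => g (L w)) M := by
  refine ⟨hg.1.comp L.contDiff, fun i hi w hw => ?_⟩
  have h1 : iteratedFDeriv ℝ i (fun w => g (L w)) w =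
      (iteratedFDeriv ℝ i g (L w)).compContinuousLinearMap fun _ => L :=
    L.iteratedFDeriv_comp_right hg.1 w (by exact_mod_cast hi)
  rw [h1]
  refine (ContinuousMultilinearMap.norm_compContinuousLinearMap_le _ _).trans ?_
  calc _ ≤ ‖iteratedFDeriv ℝ i g (L w)‖ * 1 := by
        gcongr
        exact Finset.prod_le_one (fun _ _ => norm_nonneg _) fun _ _ => hL
    _ ≤ M := by rw [mul_one]; exact hg.2 i hi _ hw

lemma HasC2Bound.subset {s s' : Set E} {g : E → F} {M : ℝ} (h : HasC2Bound s g M)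
    (hs : s' ⊆ s) : HasC2Bound s' g M :=
  ⟨h.1, fun i hi w hw => h.2 i hi w (hs hw)⟩

/-- The second derivative of `u` at `z` in the direction `e`. -/
noncomputable def secondDirDeriv (u : E → F) (e z : E) : F :=
  fderiv ℝ (fun w => fderiv ℝ u w e) z e

lemma hasFDerivAt_fderiv {u : E → F} (hu : ContDiff ℝ 2 u) (z : E) :
    HasFDerivAt (fderiv ℝ u) (fderiv ℝ (fderiv ℝ u) z) z := by
  have : ContDiff ℝ 1 (fderiv ℝ u) := hu.fderiv_right (by norm_num)
  exact (this.differentiable (by norm_num) z).hasFDerivAt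

lemma secondDirDeriv_eq_of_hasLineDerivAt {u : E → F} (hu : ContDiff ℝ 2 u) {e z : E}
    {u₁ : E → F} {u₂ : F} (h₁ : ∀ w, HasLineDerivAt ℝ u (u₁ w) w e)
    (h₂ : HasLineDerivAt ℝ u₁ u₂ z e) : secondDirDeriv u e z = u₂ := by
  have h3 : (fun w => fderiv ℝ u w e) = u₁ := by
    funext w
    rw [← ((hu.differentiable (by norm_num)) w).lineDeriv_eq_fderiv, (h₁ w).lineDeriv]
  have h4 : DifferentiableAt ℝ (fun w => fderiv ℝ u w e) z :=
    ((ContinuousLinearMap.apply ℝ F e).hasFDerivAt (x := fderiv ℝ u z)).comp z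
      (hasFDerivAt_fderiv hu z) |>.differentiableAt
  rw [secondDirDeriv, ← h4.lineDeriv_eq_fderiv, h3, h₂.lineDeriv]

lemma hasSum_fderiv_apply [CompleteSpace F] {T : ℕ → E → F} {b : ℕ → ℝ} (hb : Summable b)
    {s : Set E} (hs : IsOpen s) (hs' : IsPreconnected s) (hT : ∀ k, Differentiable ℝ (T k))
    {z : E} (hz : z ∈ s) (hT0 : Summable fun k => T k z)
    (hT1 : ∀ k, ∀ w ∈ s, ‖fderiv ℝ (T k) w‖ ≤ b k) (e : E) {w : E} (hw : w ∈ s) :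
    HasSum (fun k => fderiv ℝ (T k) w e) (fderiv ℝ (fun w => ∑' k, T k w) w e) := by
  have hd := (hasFDerivAt_tsum_of_isPreconnected hb hs hs'
      (fun k x _ => (hT k x).hasFDerivAt) hT1 hz hT0 hw).fderiv
  have hsum : Summable fun k => fderiv ℝ (T k) w :=
    Summable.of_norm_bounded hb fun k => hT1 k w hw
  rw [hd]
  exact (ContinuousLinearMap.apply ℝ F e).hasSum hsum.hasSum

lemma secondDirDeriv_tsum [CompleteSpace F] {T : ℕ → E → F} {b : ℕ → ℝ} (hb : Summable b)
    {s : Set E} (hs : IsOpen s) (hs' : IsPreconnected s) (hT : ∀ k, HasC2Bound s (T k) (b k))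
    {z : E} (hz : z ∈ s) (e : E) :
    HasSum (fun k => secondDirDeriv (T k) e z)
      (secondDirDeriv (fun w => ∑' k, T k w) e z) := by
  have hT0 : Summable fun k => T k z :=
    Summable.of_norm_bounded hb fun k => by
      rw [← norm_iteratedFDeriv_zero (𝕜 := ℝ)]; exact (hT k).2 0 (by norm_num) z hz
  have hT1 : ∀ k, ∀ w ∈ s, ‖fderiv ℝ (T k) w‖ ≤ b k := fun k w hw => by
    rw [← norm_iteratedFDeriv_one]; exact (hT k).2 1 (by norm_num) w hw
  have hT2 : ∀ k, ∀ w ∈ s, ‖fderiv ℝ (fderiv ℝ (T k)) w‖ ≤ b k := fun k w hw => by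
    rw [← norm_iteratedFDeriv_one (𝕜 := ℝ), norm_iteratedFDeriv_fderiv]
    exact (hT k).2 2 le_rfl w hw
  have hsum : ∀ w ∈ s, HasSum (fun k => fderiv ℝ (T k) w e)
      (fderiv ℝ (fun w => ∑' k, T k w) w e) := fun w hw =>
    hasSum_fderiv_apply hb hs hs' (fun k => (hT k).1.differentiable (by norm_num)) hz hT0 hT1 e hw
  have hD : ∀ k, ∀ w, HasFDerivAt (fun w => fderiv ℝ (T k) w e)
      ((ContinuousLinearMap.apply ℝ F e).comp (fderiv ℝ (fderiv ℝ (T k)) w)) w := fun k w =>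
    ((ContinuousLinearMap.apply ℝ F e).hasFDerivAt (x := fderiv ℝ (T k) w)).comp w
      (hasFDerivAt_fderiv (hT k).1 w)
  have hDb : ∀ k, ∀ w ∈ s, ‖fderiv ℝ (fun w => fderiv ℝ (T k) w e) w‖ ≤
      ‖ContinuousLinearMap.apply ℝ F e‖ * b k := fun k w hw => by
    rw [(hD k w).fderiv]
    exact (ContinuousLinearMap.opNorm_comp_le _ _).trans
      (mul_le_mul_of_nonneg_left (hT2 k w hw) (norm_nonneg _))
  have key := hasSum_fderiv_apply (hb.mul_left ‖ContinuousLinearMap.apply ℝ F e‖) hs hs'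
    (fun k w => (hD k w).differentiableAt) hz (hsum z hz).summable hDb e hz
  have hE : (fun w => fderiv ℝ (fun w => ∑' k, T k w) w e) =ᶠ[𝓝 z]
      fun w => ∑' k, fderiv ℝ (T k) w e :=
    eventually_of_mem (hs.mem_nhds hz) fun w hw => (hsum w hw).tsum_eq.symm
  rw [secondDirDeriv, hE.fderiv_eq]
  exact key

end C2Bound

lemma sum_antidiagonalTuple_succ {M : Type*} [AddCommMonoid M] (d k : ℕ)
    (g : (Fin (d + 1) → ℕ) → M) :
    ∑ ν ∈ Finset.Nat.antidiagonalTuple (d + 1) k, g ν =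
      ∑ p ∈ Finset.HasAntidiagonal.antidiagonal k, ∑ ν ∈ Finset.Nat.antidiagonalTuple d p.2, g (Fin.cons p.1 ν) := by
  rw [Finset.sum_sigma']
  symm
  refine Finset.sum_bij' (fun q _ => Fin.cons q.1.1 q.2)
    (fun ν _ => ⟨(ν 0, ∑ j, Fin.tail ν j), Fin.tail ν⟩) ?_ ?_ ?_ ?_ ?_
  · rintro ⟨⟨i, j⟩, ν⟩ h
    simp only [Finset.mem_sigma, Finset.HasAntidiagonal.mem_antidiagonal,
      Finset.Nat.mem_antidiagonalTuple] at h
    simp [Finset.Nat.mem_antidiagonalTuple, Fin.sum_univ_succ, h.1, h.2]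
  · intro ν h
    rw [Finset.Nat.mem_antidiagonalTuple, Fin.sum_univ_succ] at h
    simp [Finset.Nat.mem_antidiagonalTuple, Fin.tail, h]
  · rintro ⟨⟨i, j⟩, ν⟩ h
    simp only [Finset.mem_sigma, Finset.HasAntidiagonal.mem_antidiagonal,
      Finset.Nat.mem_antidiagonalTuple] at h
    simp [h.2]
  · intro ν h
    simp
  · rintro ⟨⟨i, j⟩, ν⟩ h
    rfl

lemma sum_inv_sqrt_le (k : ℕ) :
    ∑ i ∈ Finset.range k, (Real.sqrt ((i : ℝ) + 1))⁻¹ ≤ 2 * Real.sqrt k := by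
  induction k with
  | zero => simp
  | succ k ih =>
    rw [Finset.sum_range_succ]
    have hs : 0 < Real.sqrt ((k : ℝ) + 1) := by positivity
    have h1 : Real.sqrt ((k : ℝ) + 1) ^ 2 = k + 1 := Real.sq_sqrt (by positivity)
    have h2 : Real.sqrt (k : ℝ) ^ 2 = k := Real.sq_sqrt (by positivity)
    have h3 : (Real.sqrt ((k : ℝ) + 1))⁻¹ ≤
        2 * Real.sqrt ((k : ℝ) + 1) - 2 * Real.sqrt (k : ℝ) := by
      rw [inv_le_iff_one_le_mul₀ hs]
      nlinarith [sq_nonneg (Real.sqrt ((k : ℝ) + 1) - Real.sqrt (k : ℝ))]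
    push_cast
    linarith

/-- Counting multiindices of length `k`, weighted by the decay of the Hermite functions. -/
lemma sum_antidiagonalTuple_hermiteRate_le (d k : ℕ) :
    (∑ ν ∈ Finset.Nat.antidiagonalTuple (d + 1) k, ∏ j, hermiteRate (ν j) ^ 2) *
      Real.sqrt (k + 1) ≤ 4 ^ d * Real.sqrt (k + 1) ^ d := by
  induction d generalizing k with
  | zero =>
    have hs : 0 < Real.sqrt ((k : ℝ) + 1) := by positivity
    simp [Finset.Nat.antidiagonalTuple_one, hermiteRate_sq, hs.ne']
  | succ d ih =>
    rw [sum_antidiagonalTuple_succ]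
    simp only [Fin.prod_univ_succ (n := d + 1), Fin.cons_zero, Fin.cons_succ, hermiteRate_sq]
    simp only [← Finset.mul_sum]
    simp only [hermiteRate_sq] at ih
    set S : ℕ → ℝ := fun k => ∑ ν ∈ Finset.Nat.antidiagonalTuple (d + 1) k,
      ∏ j, (Real.sqrt ((ν j : ℝ) + 1))⁻¹ with hS
    have hS0 : ∀ k, 0 ≤ S k := fun k =>
      Finset.sum_nonneg fun ν _ => Finset.prod_nonneg fun j _ => by positivity
    change (∑ p ∈ Finset.HasAntidiagonal.antidiagonal k, (Real.sqrt ((p.1 : ℝ) + 1))⁻¹ * S p.2) * _ ≤ _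
    set r : ℕ → ℝ := fun n => Real.sqrt ((n : ℝ) + 1) with hr
    have hr0 : ∀ n, 0 < r n := fun n => by simp only [hr]; positivity
    have hr2 : ∀ n, r n ^ 2 = n + 1 := fun n => Real.sq_sqrt (by positivity)
    have hrmono : ∀ {m n}, m ≤ n → r m ≤ r n := fun {m n} h =>
      Real.sqrt_le_sqrt (by exact_mod_cast Nat.succ_le_succ h)
    change (∑ p ∈ Finset.HasAntidiagonal.antidiagonal k, (r p.1)⁻¹ * S p.2) * r k ≤ 4 ^ (d + 1) * r k ^ (d + 1)
    have ih' : ∀ k, S k * r k ≤ 4 ^ d * r k ^ d := ih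
    have hterm : ∀ p ∈ Finset.HasAntidiagonal.antidiagonal k, r k ^ 2 * ((r p.1)⁻¹ * S p.2) ≤
        4 ^ d * r k ^ (d + 1) * ((r p.1)⁻¹ + (r p.2)⁻¹) := by
      intro p hp
      have hpk : p.1 + p.2 = k := Finset.HasAntidiagonal.mem_antidiagonal.1 hp
      have h1 := hrmono (show p.1 ≤ k by omega)
      have h2 := hrmono (show p.2 ≤ k by omega)
      have h3 : r k ^ 2 ≤ r p.1 ^ 2 + r p.2 ^ 2 := by
        rw [hr2, hr2, hr2, ← hpk]; push_cast; linarith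
      have hSp : S p.2 ≤ 4 ^ d * r k ^ d * (r p.2)⁻¹ := by
        rw [← div_eq_mul_inv, le_div_iff₀ (hr0 _)]
        refine (ih' p.2).trans ?_
        gcongr
      have hSp2 : S p.2 * r p.2 ≤ 4 ^ d * r k ^ d := by
        refine (ih' p.2).trans ?_
        gcongr
      have hi := (hr0 p.1)
      have hj := (hr0 p.2)
      calc r k ^ 2 * ((r p.1)⁻¹ * S p.2)
          ≤ (r p.1 ^ 2 + r p.2 ^ 2) * ((r p.1)⁻¹ * S p.2) := by
            have := hS0 p.2
            gcongr
        _ = r p.1 * S p.2 + r p.2 * (r p.1)⁻¹ * (S p.2 * r p.2) := by field_simp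
        _ ≤ r k * (4 ^ d * r k ^ d * (r p.2)⁻¹) + r k * (r p.1)⁻¹ * (4 ^ d * r k ^ d) := by
            have := hS0 p.2
            have := hr0 k
            gcongr
        _ = _ := by ring
    have hsum1 : ∑ p ∈ Finset.HasAntidiagonal.antidiagonal k, (r p.1)⁻¹ ≤ 2 * r k := by
      rw [Finset.Nat.sum_antidiagonal_eq_sum_range_succ_mk]
      simpa using sum_inv_sqrt_le (k + 1)
    have hsum2 : ∑ p ∈ Finset.HasAntidiagonal.antidiagonal k, (r p.2)⁻¹ ≤ 2 * r k := by
      rw [← Finset.Nat.sum_antidiagonal_swap]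
      simpa using hsum1
    have htot : r k ^ 2 * ∑ p ∈ Finset.HasAntidiagonal.antidiagonal k, (r p.1)⁻¹ * S p.2 ≤
        4 ^ d * r k ^ (d + 1) * (4 * r k) := by
      rw [Finset.mul_sum]
      refine (Finset.sum_le_sum hterm).trans ?_
      rw [← Finset.mul_sum, Finset.sum_add_distrib]
      have := hr0 k
      gcongr
      linarith
    have hk := hr0 k
    refine le_of_mul_le_mul_left ?_ hk
    calc _ = r k ^ 2 * ∑ p ∈ Finset.HasAntidiagonal.antidiagonal k, (r p.1)⁻¹ * S p.2 := by ring
      _ ≤ _ := htot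
      _ = _ := by ring

section ScaledHermite

lemma one_add_scaled_sq_le {r A R s : ℝ} (hr : 0 ≤ r) (hrA : r ≤ A) (hs : |s| ≤ R) :
    1 + (r * s) ^ 2 ≤ 1 + (A * R) ^ 2 := by
  have h : |r * s| ≤ A * R := by
    rw [abs_mul, abs_of_nonneg hr]
    exact mul_le_mul hrA hs (abs_nonneg _) (hr.trans hrA)
  have := sq_le_sq' (abs_le.1 h).1 (abs_le.1 h).2
  linarith

lemma hasDerivAt_hermiteFun_scaled (n : ℕ) (r s : ℝ) :
    HasDerivAt (fun s : ℝ => (hermiteFun n (r * s) : ℂ))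
      ((r * hermiteFunDeriv n (r * s) : ℝ) : ℂ) s := by
  have h := (hermiteFun_hasDerivAt n (r * s)).comp s ((hasDerivAt_id s).const_mul r)
  have h' : HasDerivAt (fun s => hermiteFun n (r * s)) (r * hermiteFunDeriv n (r * s)) s :=
    h.congr_deriv (by ring)
  exact h'.ofReal_comp

lemma hasDerivAt_hermiteFunDeriv_scaled (n : ℕ) (r s : ℝ) :
    HasDerivAt (fun s : ℝ => ((r * hermiteFunDeriv n (r * s) : ℝ) : ℂ))
      ((r ^ 2 * (((r * s) ^ 2 - (2 * n + 1)) * hermiteFun n (r * s)) : ℝ) : ℂ) s := by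
  have h := ((hermiteFunDeriv_hasDerivAt n (r * s)).comp s
    ((hasDerivAt_id s).const_mul r)).const_mul r
  have h' : HasDerivAt (fun s => r * hermiteFunDeriv n (r * s))
      (r ^ 2 * (((r * s) ^ 2 - (2 * n + 1)) * hermiteFun n (r * s))) s :=
    h.congr_deriv (by ring)
  exact h'.ofReal_comp

lemma hasC2Bound_hermiteFun_scaled {n : ℕ} {r A R : ℝ} (hr : 0 ≤ r) (hA : 1 ≤ A)
    (hrA : r * √(n + 1) ≤ A) :
    HasC2Bound {s : ℝ | |s| ≤ R} (fun s : ℝ => (hermiteFun n (r * s) : ℂ))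
      (16 * A ^ 2 * (1 + (A * R) ^ 2) ^ 2 * hermiteRate n) := by
  have hq1 : 1 ≤ √((n : ℝ) + 1) := by
    rw [Real.one_le_sqrt]
    have : (0 : ℝ) ≤ n := n.cast_nonneg
    linarith
  have hrA' : r ≤ A := (le_mul_of_one_le_right hr hq1).trans hrA
  have hC : ContDiff ℝ 2 (fun s : ℝ => (hermiteFun n (r * s) : ℂ)) := by
    have h1 : ContDiff ℝ 2 (hermiteFun n) := contDiff_infty.1 (hermiteFun_contDiff n) 2
    exact Complex.ofRealCLM.contDiff.comp (h1.comp (contDiff_const.mul contDiff_id))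
  have hrate := hermiteRate_pos n
  refine ⟨hC, fun i hi s hs => ?_⟩
  have hx : 1 + (r * s) ^ 2 ≤ 1 + (A * R) ^ 2 := one_add_scaled_sq_le hr hrA' hs
  have hx2 : (1 + (r * s) ^ 2) ^ 2 ≤ (1 + (A * R) ^ 2) ^ 2 := by gcongr
  set Q := 1 + (A * R) ^ 2 with hQ
  have hQ1 : 1 ≤ Q := by rw [hQ]; nlinarith [sq_nonneg (A * R)]
  have hd1 : deriv (fun s : ℝ => (hermiteFun n (r * s) : ℂ)) =
      fun s => ((r * hermiteFunDeriv n (r * s) : ℝ) : ℂ) :=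
    funext fun s => (hasDerivAt_hermiteFun_scaled n r s).deriv
  have hA0 : 0 < A := by linarith
  rw [norm_iteratedFDeriv_eq_norm_iteratedDeriv]
  interval_cases i
  · rw [iteratedDeriv_zero, Complex.norm_real, Real.norm_eq_abs]
    refine (abs_hermiteFun_le n _).trans ?_
    refine mul_le_mul_of_nonneg_right ?_ hrate.le
    calc 8 * (1 + (r * s) ^ 2) ≤ 8 * Q := by gcongr
      _ ≤ 16 * 1 ^ 2 * (Q * 1) := by nlinarith
      _ ≤ 16 * A ^ 2 * (Q * Q) := by gcongr
      _ = _ := by ring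
  · rw [iteratedDeriv_one, hd1, Complex.norm_real, Real.norm_eq_abs, abs_mul, abs_of_nonneg hr]
    calc r * |hermiteFunDeriv n (r * s)|
        ≤ r * (8 * (1 + (r * s) ^ 2) ^ 2 * (√(n + 1) * hermiteRate n)) := by
          gcongr; exact abs_hermiteFunDeriv_le n _
      _ = 8 * (1 + (r * s) ^ 2) ^ 2 * (r * √(n + 1)) * hermiteRate n := by ring
      _ ≤ 8 * Q ^ 2 * A * hermiteRate n := by gcongr
      _ ≤ 16 * Q ^ 2 * (A * A) * hermiteRate n := by
          gcongr
          · norm_num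
          · nlinarith
      _ = _ := by ring
  · rw [iteratedDeriv_succ, iteratedDeriv_one, hd1,
      (hasDerivAt_hermiteFunDeriv_scaled n r s).deriv, Complex.norm_real, Real.norm_eq_abs,
      abs_mul, abs_of_nonneg (sq_nonneg r)]
    calc r ^ 2 * |((r * s) ^ 2 - (2 * n + 1)) * hermiteFun n (r * s)|
        ≤ r ^ 2 * (16 * (1 + (r * s) ^ 2) ^ 2 * (√(n + 1) ^ 2 * hermiteRate n)) := by
          gcongr; exact abs_hermiteFun_second_le n _
      _ = 16 * (1 + (r * s) ^ 2) ^ 2 * (r * √(n + 1)) ^ 2 * hermiteRate n := by ring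
      _ ≤ 16 * Q ^ 2 * A ^ 2 * hermiteRate n := by gcongr
      _ = _ := by ring

lemma scaledHermite_ofReal (d : ℕ) (a : ℝ) (ν : Fin d → ℕ) (x : Fin d → ℝ) :
    (scaledHermite d a ν x : ℂ) =
      ((|a| ^ ((d : ℝ) / 4) : ℝ) : ℂ) * ∏ j, (hermiteFun (ν j) (√|a| * x j) : ℂ) := by
  simp [scaledHermite, hermiteFunMulti]

lemma hasC2Bound_scaledHermite {d d' : ℕ} {a A R : ℝ} {ν : Fin d → ℕ} (hA : 1 ≤ A)
    (hν : ∀ j, √|a| * √(ν j + 1) ≤ A) :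
    HasC2Bound (Metric.ball (0 : (Fin d → ℝ) × (Fin d' → ℝ)) R)
      (fun w => (scaledHermite d a ν w.1 : ℂ))
      (|a| ^ ((d : ℝ) / 4) * ((64 * A ^ 2 * (1 + (A * R) ^ 2) ^ 2) ^ d * ∏ j, hermiteRate (ν j))) := by
  simp only [scaledHermite_ofReal]
  have h1 : ∀ j ∈ Finset.univ, HasC2Bound (Metric.ball (0 : (Fin d → ℝ) × (Fin d' → ℝ)) R)
      (fun w => (hermiteFun (ν j) (√|a| * w.1 j) : ℂ))
      (16 * A ^ 2 * (1 + (A * R) ^ 2) ^ 2 * hermiteRate (ν j)) := fun j _ => by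
    let L : ((Fin d → ℝ) × (Fin d' → ℝ)) →L[ℝ] ℝ :=
      (ContinuousLinearMap.proj j).comp (ContinuousLinearMap.fst ℝ (Fin d → ℝ) (Fin d' → ℝ))
    have hLw : ∀ w, ‖L w‖ ≤ ‖w‖ := fun w => (norm_le_pi_norm w.1 j).trans (norm_fst_le w)
    have hL : ‖L‖ ≤ 1 := L.opNorm_le_bound zero_le_one fun w => by simpa using hLw w
    refine ((hasC2Bound_hermiteFun_scaled (Real.sqrt_nonneg _) hA (hν j)).comp_clm L hL).subset ?_
    intro w hw
    rw [mem_ball_zero_iff] at hw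
    exact (hLw w).trans hw.le
  have h2 := (HasC2Bound.prod Finset.univ h1).const_smul ((|a| ^ ((d : ℝ) / 4) : ℝ) : ℂ)
  refine h2.mono (le_of_eq ?_)
  rw [Complex.norm_real, Real.norm_of_nonneg (by positivity)]
  congr 1
  have h3 : ∀ j, 4 * (16 * A ^ 2 * (1 + (A * R) ^ 2) ^ 2 * hermiteRate (ν j)) =
      64 * A ^ 2 * (1 + (A * R) ^ 2) ^ 2 * hermiteRate (ν j) := fun j => by ring
  simp only [h3]
  rw [Finset.prod_mul_distrib, Finset.prod_const, Finset.card_univ, Fintype.card_fin]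

lemma abs_scaledHermite_le {d : ℕ} {a A : ℝ} {ν : Fin d → ℕ} (hA : 1 ≤ A)
    (hν : √|a| ≤ A) (x : Fin d → ℝ) :
    |scaledHermite d a ν x| ≤
      |a| ^ ((d : ℝ) / 4) * ((8 * A ^ 2) ^ d * (1 + ‖x‖ ^ 2) ^ d * ∏ j, hermiteRate (ν j)) := by
  rw [scaledHermite, hermiteFunMulti, abs_mul, abs_of_nonneg (by positivity : 0 ≤ |a| ^ ((d : ℝ) / 4)),
    Finset.abs_prod]
  gcongr
  calc ∏ j, |hermiteFun (ν j) (√|a| * x j)|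
      ≤ ∏ j, (8 * A ^ 2 * (1 + ‖x‖ ^ 2) * hermiteRate (ν j)) := by
        refine Finset.prod_le_prod (fun _ _ => abs_nonneg _) fun j _ => ?_
        refine (abs_hermiteFun_le _ _).trans ?_
        have h1 := one_add_scaled_sq_le (Real.sqrt_nonneg |a|) hν (norm_le_pi_norm x j)
        have h2 : 1 + (A * ‖x‖) ^ 2 ≤ A ^ 2 * (1 + ‖x‖ ^ 2) := by nlinarith
        have := hermiteRate_pos (ν j)
        refine mul_le_mul_of_nonneg_right ?_ this.le
        linarith
    _ = _ := by
        rw [Finset.prod_mul_distrib, Finset.prod_const, Finset.card_univ, Fintype.card_fin, mul_pow]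

lemma continuous_scaledHermite (d : ℕ) (a : ℝ) (ν : Fin d → ℕ) :
    Continuous (scaledHermite d a ν) := by
  unfold scaledHermite hermiteFunMulti
  refine continuous_const.mul (continuous_finsetProd _ fun j _ => ?_)
  exact (hermiteFun_contDiff (ν j)).continuous.comp (by fun_prop)

/-- The partial derivative of `scaledHermite` in the `j`-th coordinate. -/
noncomputable def scaledHermiteDeriv (d : ℕ) (a : ℝ) (ν : Fin d → ℕ) (j : Fin d)
    (x : Fin d → ℝ) : ℝ :=
  |a| ^ ((d : ℝ) / 4) * ((√|a| * hermiteFunDeriv (ν j) (√|a| * x j)) *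
    ∏ i ∈ Finset.univ.erase j, hermiteFun (ν i) (√|a| * x i))

lemma hasDerivAt_mul_prod_erase {d : ℕ} {g : ℝ → ℝ} {g' : ℝ} (G : Fin d → ℝ → ℝ) (c : ℝ)
    (x : Fin d → ℝ) (j : Fin d) (hg : HasDerivAt g g' (x j)) :
    HasDerivAt (fun s : ℝ => c * (g ((x + s • (Pi.single j 1 : Fin d → ℝ)) j) *
        ∏ i ∈ Finset.univ.erase j, G i ((x + s • (Pi.single j 1 : Fin d → ℝ)) i)))
      (c * (g' * ∏ i ∈ Finset.univ.erase j, G i (x i))) 0 := by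
  have h1 : ∀ s : ℝ, ∏ i ∈ Finset.univ.erase j, G i ((x + s • (Pi.single j 1 : Fin d → ℝ)) i) =
      ∏ i ∈ Finset.univ.erase j, G i (x i) := fun s => Finset.prod_congr rfl fun i hi => by
    simp [Pi.single_eq_of_ne (Finset.ne_of_mem_erase hi)]
  simp only [h1]
  refine (HasDerivAt.mul_const ?_ _).const_mul c
  have h2 : HasDerivAt (fun s : ℝ => x j + s) 1 0 := (hasDerivAt_id (0 : ℝ)).const_add _
  have h3 : HasDerivAt g g' (x j + 0) := by simpa using hg
  simpa [Function.comp_def] using h3.comp (0 : ℝ) h2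

lemma scaledHermite_eq_erase (d : ℕ) (a : ℝ) (ν : Fin d → ℕ) (j : Fin d) (x : Fin d → ℝ) :
    scaledHermite d a ν x = |a| ^ ((d : ℝ) / 4) * (hermiteFun (ν j) (√|a| * x j) *
      ∏ i ∈ Finset.univ.erase j, hermiteFun (ν i) (√|a| * x i)) := by
  rw [scaledHermite, hermiteFunMulti,
    Finset.mul_prod_erase Finset.univ (fun i => hermiteFun (ν i) (√|a| * x i)) (Finset.mem_univ j)]

lemma hasLineDerivAt_scaledHermite (d : ℕ) (a : ℝ) (ν : Fin d → ℕ) (j : Fin d) (x : Fin d → ℝ) :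
    HasLineDerivAt ℝ (scaledHermite d a ν) (scaledHermiteDeriv d a ν j x) x (Pi.single j 1) := by
  have hg : HasDerivAt (fun s => hermiteFun (ν j) (√|a| * s))
      (√|a| * hermiteFunDeriv (ν j) (√|a| * x j)) (x j) := by
    have h := (hermiteFun_hasDerivAt (ν j) (√|a| * x j)).comp (x j)
      ((hasDerivAt_id (x j)).const_mul √|a|)
    exact h.congr_deriv (by ring)
  have h := hasDerivAt_mul_prod_erase (fun i s => hermiteFun (ν i) (√|a| * s))
    (|a| ^ ((d : ℝ) / 4)) x j hg
  rw [HasLineDerivAt, funext fun s : ℝ => scaledHermite_eq_erase d a ν j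
    (x + s • (Pi.single j 1 : Fin d → ℝ))]
  exact h

lemma hasLineDerivAt_scaledHermiteDeriv (d : ℕ) (a : ℝ) (ν : Fin d → ℕ) (j : Fin d)
    (x : Fin d → ℝ) :
    HasLineDerivAt ℝ (scaledHermiteDeriv d a ν j)
      (|a| * (|a| * x j ^ 2 - (2 * ν j + 1)) * scaledHermite d a ν x) x (Pi.single j 1) := by
  have hg : HasDerivAt (fun s => √|a| * hermiteFunDeriv (ν j) (√|a| * s))
      (√|a| ^ 2 * ((((√|a| * x j) ^ 2 - (2 * ν j + 1)) * hermiteFun (ν j) (√|a| * x j)))) (x j) := by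
    have h := ((hermiteFunDeriv_hasDerivAt (ν j) (√|a| * x j)).comp (x j)
      ((hasDerivAt_id (x j)).const_mul √|a|)).const_mul √|a|
    exact h.congr_deriv (by ring)
  have h := hasDerivAt_mul_prod_erase (fun i s => hermiteFun (ν i) (√|a| * s))
    (|a| ^ ((d : ℝ) / 4)) x j hg
  have hval : |a| * (|a| * x j ^ 2 - (2 * ν j + 1)) * scaledHermite d a ν x =
      |a| ^ ((d : ℝ) / 4) * ((√|a| ^ 2 * ((((√|a| * x j) ^ 2 - (2 * ν j + 1)) *
        hermiteFun (ν j) (√|a| * x j)))) *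
        ∏ i ∈ Finset.univ.erase j, hermiteFun (ν i) (√|a| * x i)) := by
    rw [scaledHermite_eq_erase d a ν j, mul_pow, Real.sq_sqrt (abs_nonneg a)]
    ring
  rw [HasLineDerivAt, hval]
  exact h

end ScaledHermite

section SphereTransform

instance sphereMeasure.instIsFiniteMeasure (n : ℕ) : IsFiniteMeasure (sphereMeasure n) := by
  unfold sphereMeasure; infer_instance

/-- The Fourier transform, at frequency `a t`, of the density `g` on the unit sphere. -/
noncomputable def sphereTransform {n : ℕ} (g : EuclideanSpace ℝ (Fin n) → ℂ) (a : ℝ)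
    (t : Fin n → ℝ) : ℂ :=
  ∫ ε : Metric.sphere (0 : EuclideanSpace ℝ (Fin n)) 1,
    g ε * Complex.exp (-Complex.I *
      ((a * ∑ j, t j * (ε : EuclideanSpace ℝ (Fin n)) j : ℝ) : ℂ)) ∂(sphereMeasure n)

lemma continuous_sphere_integrable {n : ℕ} {G : Type*} [NormedAddCommGroup G]
    {g : Metric.sphere (0 : EuclideanSpace ℝ (Fin n)) 1 → G} (hg : Continuous g) :
    Integrable g (sphereMeasure n) :=
  hg.integrable_of_hasCompactSupport (HasCompactSupport.of_compactSpace g)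

lemma norm_exp_neg_I_mul (x : ℝ) : ‖Complex.exp (-Complex.I * (x : ℂ))‖ = 1 := by
  have : -Complex.I * (x : ℂ) = ((-x : ℝ) : ℂ) * Complex.I := by push_cast; ring
  rw [this, Complex.norm_exp_ofReal_mul_I]

lemma continuous_sphereTransform_integrand {n : ℕ} {g : EuclideanSpace ℝ (Fin n) → ℂ}
    (hg : Continuous g) (a : ℝ) (t : Fin n → ℝ) :
    Continuous fun ε : Metric.sphere (0 : EuclideanSpace ℝ (Fin n)) 1 =>
      g ε * Complex.exp (-Complex.I *
        ((a * ∑ j, t j * (ε : EuclideanSpace ℝ (Fin n)) j : ℝ) : ℂ)) := by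
  fun_prop

lemma hasLineDerivAt_sphereTransform {n : ℕ} {g : EuclideanSpace ℝ (Fin n) → ℂ}
    (hg : Continuous g) (a : ℝ) (j : Fin n) (t : Fin n → ℝ) :
    HasLineDerivAt ℝ (sphereTransform g a)
      (sphereTransform (fun v => -Complex.I * ((a * v j : ℝ) : ℂ) * g v) a t) t
      (Pi.single j 1) := by
  have hg' : Continuous fun v : EuclideanSpace ℝ (Fin n) =>
      -Complex.I * ((a * v j : ℝ) : ℂ) * g v := by fun_prop
  have hbound : Continuous fun ε : Metric.sphere (0 : EuclideanSpace ℝ (Fin n)) 1 =>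
      ‖-Complex.I * ((a * (ε : EuclideanSpace ℝ (Fin n)) j : ℝ) : ℂ) * g ε‖ :=
    (hg'.comp continuous_subtype_val).norm
  have key := hasDerivAt_integral_of_dominated_loc_of_deriv_le (𝕜 := ℝ) (μ := sphereMeasure n)
    (F := fun (s : ℝ) (ε : Metric.sphere (0 : EuclideanSpace ℝ (Fin n)) 1) =>
      g ε * Complex.exp (-Complex.I * ((a * ∑ i, (t + s • (Pi.single j 1 : Fin n → ℝ)) i *
        (ε : EuclideanSpace ℝ (Fin n)) i : ℝ) : ℂ)))
    (F' := fun (s : ℝ) (ε : Metric.sphere (0 : EuclideanSpace ℝ (Fin n)) 1) =>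
      -Complex.I * ((a * (ε : EuclideanSpace ℝ (Fin n)) j : ℝ) : ℂ) * g ε *
      Complex.exp (-Complex.I * ((a * ∑ i, (t + s • (Pi.single j 1 : Fin n → ℝ)) i *
        (ε : EuclideanSpace ℝ (Fin n)) i : ℝ) : ℂ)))
    (x₀ := 0) (s := univ) univ_mem
    (Eventually.of_forall fun s =>
      (continuous_sphereTransform_integrand hg a _).aestronglyMeasurable)
    (continuous_sphere_integrable (continuous_sphereTransform_integrand hg a _))
    (continuous_sphereTransform_integrand hg' a _).aestronglyMeasurable
    (bound := fun ε => ‖-Complex.I * ((a * (ε : EuclideanSpace ℝ (Fin n)) j : ℝ) : ℂ) * g ε‖)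
    (Eventually.of_forall fun ε s _ => by rw [norm_mul, norm_exp_neg_I_mul, mul_one])
    (continuous_sphere_integrable hbound)
    (Eventually.of_forall fun ε s _ => by
      have h1 : ∀ s : ℝ, a * ∑ i, (t + s • (Pi.single j 1 : Fin n → ℝ)) i *
          (ε : EuclideanSpace ℝ (Fin n)) i = a * ∑ i, t i * (ε : EuclideanSpace ℝ (Fin n)) i +
            s * (a * (ε : EuclideanSpace ℝ (Fin n)) j) := fun s => by
        simp only [Pi.add_apply, Pi.smul_apply, smul_eq_mul, add_mul, Finset.sum_add_distrib,
          mul_add]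
        simp [Pi.single_apply]
        ring
      simp only [h1]
      have h2 : HasDerivAt (fun s : ℝ => a * ∑ i, t i * (ε : EuclideanSpace ℝ (Fin n)) i +
          s * (a * (ε : EuclideanSpace ℝ (Fin n)) j)) (a * (ε : EuclideanSpace ℝ (Fin n)) j) s := by
        simpa using ((hasDerivAt_id s).mul_const (a * (ε : EuclideanSpace ℝ (Fin n)) j)).const_add
          (a * ∑ i, t i * (ε : EuclideanSpace ℝ (Fin n)) i)
      have h3 := (((h2.ofReal_comp).const_mul (-Complex.I)).cexp).const_mul (g ε)
      exact h3.congr_deriv (by ring))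
  have h := key.2
  simp only [zero_smul, add_zero] at h
  exact h

lemma sphereTransform_congr {n : ℕ} {g g' : EuclideanSpace ℝ (Fin n) → ℂ}
    (h : ∀ v, ‖v‖ = 1 → g v = g' v) (a : ℝ) (t : Fin n → ℝ) :
    sphereTransform g a t = sphereTransform g' a t := by
  unfold sphereTransform
  congr 1
  funext ε
  rw [h ε (by simp)]

lemma sphereTransform_sum {n : ℕ} {ι : Type*} (s : Finset ι)
    {g : ι → EuclideanSpace ℝ (Fin n) → ℂ} (hg : ∀ j, Continuous (g j)) (a : ℝ)
    (t : Fin n → ℝ) :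
    ∑ j ∈ s, sphereTransform (g j) a t = sphereTransform (fun v => ∑ j ∈ s, g j v) a t := by
  unfold sphereTransform
  rw [← integral_finsetSum _ fun j _ =>
    continuous_sphere_integrable (continuous_sphereTransform_integrand (hg j) a t)]
  simp only [Finset.sum_mul]

lemma sphereTransform_const_mul {n : ℕ} (c : ℂ) (g : EuclideanSpace ℝ (Fin n) → ℂ) (a : ℝ)
    (t : Fin n → ℝ) :
    sphereTransform (fun v => c * g v) a t = c * sphereTransform g a t := by
  unfold sphereTransform
  rw [← integral_const_mul]
  simp only [mul_assoc]

/-- On the unit sphere, `sphereTransform` turns into an eigenfunction of the Laplacian. -/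
lemma sum_sphereTransform_sq {n : ℕ} {g : EuclideanSpace ℝ (Fin n) → ℂ} (hg : Continuous g)
    (a : ℝ) (t : Fin n → ℝ) :
    ∑ j, sphereTransform (fun v => -Complex.I * ((a * v j : ℝ) : ℂ) *
      (-Complex.I * ((a * v j : ℝ) : ℂ) * g v)) a t = -(a : ℂ) ^ 2 * sphereTransform g a t := by
  rw [sphereTransform_sum _ (fun j => by fun_prop), ← sphereTransform_const_mul]
  refine sphereTransform_congr (fun v hv => ?_) a t
  have h1 : ∑ j, v j ^ 2 = 1 := by
    have := EuclideanSpace.real_norm_sq_eq v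
    rw [hv] at this
    simpa using this.symm
  have h2 : ∑ j, ((v j : ℂ)) ^ 2 = 1 := by exact_mod_cast congrArg (fun x : ℝ => (x : ℂ)) h1
  calc _ = ∑ j, -(a : ℂ) ^ 2 * g v * (v j : ℂ) ^ 2 := by
        refine Finset.sum_congr rfl fun j _ => ?_
        push_cast
        linear_combination (a : ℂ) ^ 2 * (v j : ℂ) ^ 2 * g v * Complex.I_sq
    _ = _ := by rw [← Finset.mul_sum, h2, mul_one]

/-- The pairing between frequencies and points. -/
noncomputable def coordPairing (n : ℕ) :
    EuclideanSpace ℝ (Fin n) →L[ℝ] (Fin n → ℝ) →L[ℝ] ℝ :=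
  ∑ j, (EuclideanSpace.proj j : EuclideanSpace ℝ (Fin n) →L[ℝ] ℝ).smulRight
    (ContinuousLinearMap.proj j : (Fin n → ℝ) →L[ℝ] ℝ)

lemma coordPairing_apply (n : ℕ) (v : EuclideanSpace ℝ (Fin n)) (t : Fin n → ℝ) :
    coordPairing n v t = ∑ j, t j * v j := by
  simp [coordPairing, mul_comm]

lemma sphereTransform_eq_fourierIntegral {n : ℕ} (g : EuclideanSpace ℝ (Fin n) → ℂ) (a : ℝ) :
    sphereTransform g a = VectorFourier.fourierIntegral Real.fourierChar
      ((sphereMeasure n).map Subtype.val)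
      ((a / (2 * Real.pi)) • coordPairing n).toLinearMap₁₂ g := by
  funext t
  unfold sphereTransform VectorFourier.fourierIntegral
  rw [(MeasurableEmbedding.subtype_coe Metric.isClosed_sphere.measurableSet).integral_map]
  congr 1
  funext ε
  rw [Circle.smul_def, Real.fourierChar_apply, smul_eq_mul, mul_comm]
  congr 2
  change _ = ((2 * Real.pi * -(a / (2 * Real.pi) * coordPairing n ε t) : ℝ) : ℂ) * Complex.I
  rw [coordPairing_apply]
  have : 2 * Real.pi * -(a / (2 * Real.pi) * ∑ j, t j * (ε : EuclideanSpace ℝ (Fin n)) j) =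
      -(a * ∑ j, t j * (ε : EuclideanSpace ℝ (Fin n)) j) := by
    field_simp
  rw [this]
  push_cast
  ring

lemma hasC2Bound_sphereTransform {n : ℕ} {g : EuclideanSpace ℝ (Fin n) → ℂ} (hg : Continuous g)
    (a : ℝ) {C : ℝ} (hC : ∀ v, ‖v‖ = 1 → ‖g v‖ ≤ C) :
    HasC2Bound univ (sphereTransform g a)
      ((1 + |a| * ‖coordPairing n‖) ^ 2 * (sphereMeasure n).real univ * C) := by
  set L := (a / (2 * Real.pi)) • coordPairing n with hL
  have hpi : 0 < 2 * Real.pi := by positivity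
  have hLn : 2 * Real.pi * ‖L‖ ≤ |a| * ‖coordPairing n‖ := by
    have h1 : ‖L‖ ≤ |a| / (2 * Real.pi) * ‖coordPairing n‖ := by
      refine L.opNorm_le_bound (by positivity) fun v => ?_
      have h2 : L v = (a / (2 * Real.pi)) • coordPairing n v := rfl
      rw [h2, norm_smul, Real.norm_eq_abs, abs_div, abs_of_pos hpi, mul_assoc]
      gcongr
      exact (coordPairing n).le_opNorm v
    calc 2 * Real.pi * ‖L‖ ≤ 2 * Real.pi * (|a| / (2 * Real.pi) * ‖coordPairing n‖) := by gcongr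
      _ = _ := by field_simp
  have hemb : MeasurableEmbedding
      (Subtype.val : Metric.sphere (0 : EuclideanSpace ℝ (Fin n)) 1 → EuclideanSpace ℝ (Fin n)) :=
    MeasurableEmbedding.subtype_coe Metric.isClosed_sphere.measurableSet
  have hfi : ∀ m : ℕ, (m : ℕ∞) ≤ (2 : ℕ) →
      Integrable (fun v => ‖v‖ ^ m * ‖g v‖) ((sphereMeasure n).map Subtype.val) := fun m _ => by
    rw [hemb.integrable_map_iff]
    refine continuous_sphere_integrable ?_
    simp only [Function.comp_def]
    fun_prop
  have hmeas : AEStronglyMeasurable g ((sphereMeasure n).map Subtype.val) :=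
    hg.aestronglyMeasurable
  rw [sphereTransform_eq_fourierIntegral]
  refine ⟨by exact_mod_cast VectorFourier.contDiff_fourierIntegral L hfi, fun i hi w _ => ?_⟩
  rw [VectorFourier.iteratedFDeriv_fourierIntegral L hfi hmeas (by exact_mod_cast hi)]
  refine (VectorFourier.norm_fourierIntegral_le_integral_norm _ _ _ _ _).trans ?_
  rw [hemb.integral_map]
  have hpt : ∀ ε : Metric.sphere (0 : EuclideanSpace ℝ (Fin n)) 1,
      ‖VectorFourier.fourierPowSMulRight L g ε i‖ ≤ (1 + |a| * ‖coordPairing n‖) ^ 2 * C := by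
    intro ε
    have hε : ‖(ε : EuclideanSpace ℝ (Fin n))‖ = 1 := by simp
    refine (VectorFourier.norm_fourierPowSMulRight_le L g ε i).trans ?_
    rw [hε, one_pow, mul_one]
    have hD : 0 ≤ |a| * ‖coordPairing n‖ := by positivity
    gcongr
    · calc (2 * Real.pi * ‖L‖) ^ i ≤ (1 + |a| * ‖coordPairing n‖) ^ i := by
            gcongr; linarith
        _ ≤ _ := pow_le_pow_right₀ (by linarith) hi
    · exact hC _ hε
  refine (integral_mono_of_nonneg (Eventually.of_forall fun _ => norm_nonneg _)
    (integrable_const _) (Eventually.of_forall hpt)).trans (le_of_eq ?_)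
  rw [integral_const, smul_eq_mul]
  ring

end SphereTransform

section HermiteCoefficient

variable {d₁ d₂ : ℕ}

lemma integrable_schwartz_mul_one_add_sq (f : SchwartzMap ((Fin d₁ → ℝ) × (Fin d₂ → ℝ)) ℂ)
    (m : ℕ) : Integrable fun z => ‖f z‖ * (1 + ‖z‖ ^ 2) ^ m := by
  have : (volume : Measure ((Fin d₁ → ℝ) × (Fin d₂ → ℝ))).IsAddHaarMeasure :=
    Measure.prod.instIsAddHaarMeasure (volume : Measure (Fin d₁ → ℝ))
      (volume : Measure (Fin d₂ → ℝ))
  have h : Integrable fun z => 2 ^ (m - 1) * (‖f z‖ + ‖z‖ ^ (2 * m) * ‖f z‖) :=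
    (f.integrable.norm.add (f.integrable_pow_mul volume (2 * m))).const_mul _
  refine h.mono' ?_ (Eventually.of_forall fun z => ?_)
  · have := f.continuous
    exact Continuous.aestronglyMeasurable (by fun_prop)
  · rw [Real.norm_of_nonneg (by positivity)]
    have h1 := add_pow_le (zero_le_one (α := ℝ)) (sq_nonneg ‖z‖) m
    rw [one_pow, ← pow_mul] at h1
    calc _ ≤ ‖f z‖ * (2 ^ (m - 1) * (1 + ‖z‖ ^ (2 * m))) := by gcongr
      _ = _ := by ring

/-- The Hermite coefficient of index `ν` of the partial Fourier transform of `f` at frequency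
`a v`. -/
noncomputable def partialHermiteCoeff (f : (Fin d₁ → ℝ) × (Fin d₂ → ℝ) → ℂ) (a : ℝ)
    (ν : Fin d₁ → ℕ) (v : EuclideanSpace ℝ (Fin d₂)) : ℂ :=
  ∫ y : Fin d₁ → ℝ, partialFT d₁ d₂ f (fun j => a * v j) y * (scaledHermite d₁ a ν y : ℂ)

lemma norm_exp_I_mul (x : ℝ) : ‖Complex.exp (Complex.I * (x : ℂ))‖ = 1 := by
  rw [mul_comm, Complex.norm_exp_ofReal_mul_I]

lemma norm_partialHermiteCoeff_integrand_le (f : (Fin d₁ → ℝ) × (Fin d₂ → ℝ) → ℂ)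
    {a A : ℝ} (ν : Fin d₁ → ℕ) (hA : 1 ≤ A) (haA : √|a| ≤ A) (v : EuclideanSpace ℝ (Fin d₂))
    (z : (Fin d₁ → ℝ) × (Fin d₂ → ℝ)) :
    ‖f z * Complex.exp (Complex.I * (∑ j, a * v j * z.2 j : ℝ)) * (scaledHermite d₁ a ν z.1 : ℂ)‖ ≤
      |a| ^ ((d₁ : ℝ) / 4) * (8 * A ^ 2) ^ d₁ * (∏ j, hermiteRate (ν j)) *
        (‖f z‖ * (1 + ‖z‖ ^ 2) ^ d₁) := by
  rw [norm_mul, norm_mul, norm_exp_I_mul, mul_one, Complex.norm_real, Real.norm_eq_abs]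
  have h1 := abs_scaledHermite_le (ν := ν) hA haA z.1
  have h2 : 0 ≤ ∏ j, hermiteRate (ν j) := Finset.prod_nonneg fun j _ => (hermiteRate_pos _).le
  calc _ ≤ ‖f z‖ * (|a| ^ ((d₁ : ℝ) / 4) * ((8 * A ^ 2) ^ d₁ * (1 + ‖z‖ ^ 2) ^ d₁ *
        ∏ j, hermiteRate (ν j))) := by
        refine mul_le_mul_of_nonneg_left (h1.trans ?_) (norm_nonneg _)
        gcongr
        exact norm_fst_le z
    _ = _ := by ring

lemma continuous_partialHermiteCoeff_integrand {f : (Fin d₁ → ℝ) × (Fin d₂ → ℝ) → ℂ}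
    (hf : Continuous f) (a : ℝ) (ν : Fin d₁ → ℕ) :
    Continuous fun p : EuclideanSpace ℝ (Fin d₂) × ((Fin d₁ → ℝ) × (Fin d₂ → ℝ)) =>
      f p.2 * Complex.exp (Complex.I * (∑ j, a * p.1 j * p.2.2 j : ℝ)) *
        (scaledHermite d₁ a ν p.2.1 : ℂ) := by
  have := continuous_scaledHermite d₁ a ν
  fun_prop

lemma partialHermiteCoeff_eq (f : SchwartzMap ((Fin d₁ → ℝ) × (Fin d₂ → ℝ)) ℂ) (a : ℝ)
    (ν : Fin d₁ → ℕ) (v : EuclideanSpace ℝ (Fin d₂)) :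
    partialHermiteCoeff f a ν v = ∫ z : (Fin d₁ → ℝ) × (Fin d₂ → ℝ),
      f z * Complex.exp (Complex.I * (∑ j, a * v j * z.2 j : ℝ)) *
        (scaledHermite d₁ a ν z.1 : ℂ) := by
  have hA : (1 : ℝ) ≤ 1 + √|a| := by linarith [Real.sqrt_nonneg |a|]
  have haA : √|a| ≤ 1 + √|a| := by linarith
  have hfi : Integrable (fun z : (Fin d₁ → ℝ) × (Fin d₂ → ℝ) =>
      f z * Complex.exp (Complex.I * (∑ j, a * v j * z.2 j : ℝ)) *
        (scaledHermite d₁ a ν z.1 : ℂ)) (volume.prod volume) := by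
    refine ((integrable_schwartz_mul_one_add_sq f d₁).const_mul _).mono' ?_
      (Eventually.of_forall (norm_partialHermiteCoeff_integrand_le f ν hA haA v))
    exact ((continuous_partialHermiteCoeff_integrand f.continuous a ν).comp
      (Continuous.prodMk_right v)).aestronglyMeasurable
  rw [Measure.volume_eq_prod, integral_prod _ hfi]
  unfold partialHermiteCoeff partialFT
  simp only [integral_mul_const]

lemma continuous_partialHermiteCoeff (f : SchwartzMap ((Fin d₁ → ℝ) × (Fin d₂ → ℝ)) ℂ) (a : ℝ)
    (ν : Fin d₁ → ℕ) : Continuous (partialHermiteCoeff (d₂ := d₂) f a ν) := by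
  have hA : (1 : ℝ) ≤ 1 + √|a| := by linarith [Real.sqrt_nonneg |a|]
  have haA : √|a| ≤ 1 + √|a| := by linarith
  have hc := continuous_partialHermiteCoeff_integrand f.continuous a ν
  rw [funext (partialHermiteCoeff_eq f a ν)]
  exact continuous_of_dominated
    (fun v => (hc.comp (Continuous.prodMk_right v)).aestronglyMeasurable)
    (fun v => Eventually.of_forall (norm_partialHermiteCoeff_integrand_le f ν hA haA v))
    ((integrable_schwartz_mul_one_add_sq f d₁).const_mul _)
    (Eventually.of_forall fun z => hc.comp (Continuous.prodMk_left z))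

lemma norm_partialHermiteCoeff_le (f : SchwartzMap ((Fin d₁ → ℝ) × (Fin d₂ → ℝ)) ℂ)
    {a A : ℝ} (ν : Fin d₁ → ℕ) (hA : 1 ≤ A) (haA : √|a| ≤ A) (v : EuclideanSpace ℝ (Fin d₂)) :
    ‖partialHermiteCoeff f a ν v‖ ≤
      |a| ^ ((d₁ : ℝ) / 4) * (8 * A ^ 2) ^ d₁ * (∏ j, hermiteRate (ν j)) *
        ∫ z, ‖f z‖ * (1 + ‖z‖ ^ 2) ^ d₁ := by
  rw [partialHermiteCoeff_eq, ← integral_const_mul]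
  exact norm_integral_le_of_norm_le ((integrable_schwartz_mul_one_add_sq f d₁).const_mul _)
    (Eventually.of_forall (norm_partialHermiteCoeff_integrand_le f ν hA haA v))

end HermiteCoefficient

section Layer

variable {d₁ d₂ : ℕ}

/-- The part of the restriction operator which comes from the multiindices of length `k`, at
frequency `a`. -/
noncomputable def hermiteLayer (f : (Fin d₁ → ℝ) × (Fin d₂ → ℝ) → ℂ) (a : ℝ) (k : ℕ)
    (w : (Fin d₁ → ℝ) × (Fin d₂ → ℝ)) : ℂ :=
  ∑ ν ∈ Finset.Nat.antidiagonalTuple d₁ k,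
    (scaledHermite d₁ a ν w.1 : ℂ) * sphereTransform (partialHermiteCoeff f a ν) a w.2

lemma integral_hermiteProj_eq_hermiteLayer (f : SchwartzMap ((Fin d₁ → ℝ) × (Fin d₂ → ℝ)) ℂ)
    (a : ℝ) (k : ℕ) (x : Fin d₁ → ℝ) (t : Fin d₂ → ℝ) :
    ∫ ε : Metric.sphere (0 : EuclideanSpace ℝ (Fin d₂)) 1,
      hermiteProj d₁ k a (partialFT d₁ d₂ f (fun j => a * (ε : EuclideanSpace ℝ (Fin d₂)) j)) x *
        Complex.exp (-Complex.I *
          ((a * ∑ j, t j * (ε : EuclideanSpace ℝ (Fin d₂)) j : ℝ) : ℂ)) ∂(sphereMeasure d₂) =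
      hermiteLayer f a k (x, t) := by
  have h : ∀ ν ∈ Finset.Nat.antidiagonalTuple d₁ k,
      (scaledHermite d₁ a ν x : ℂ) * sphereTransform (partialHermiteCoeff f a ν) a t =
      sphereTransform (fun v => (scaledHermite d₁ a ν x : ℂ) * partialHermiteCoeff f a ν v) a t :=
    fun ν _ => (sphereTransform_const_mul _ _ a t).symm
  rw [hermiteLayer, Finset.sum_congr rfl h, sphereTransform_sum
    (g := fun ν v => (scaledHermite d₁ a ν x : ℂ) * partialHermiteCoeff f a ν v) _ fun ν =>
    continuous_const.mul (continuous_partialHermiteCoeff f a ν)]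
  unfold sphereTransform
  congr 1
  funext ε
  congr 1
  rw [hermiteProj]
  exact Finset.sum_congr rfl fun ν _ => mul_comm _ _

lemma restOp_eq_tsum (f : SchwartzMap ((Fin d₁ → ℝ) × (Fin d₂ → ℝ)) ℂ) (μ : ℝ)
    (w : (Fin d₁ → ℝ) × (Fin d₂ → ℝ)) :
    restOp d₁ d₂ μ f w.1 w.2 = ∑' k : ℕ,
      ((1 / (2 * Real.pi) * (μ ^ (d₂ - 1) / (2 * (k : ℝ) + d₁) ^ d₂) : ℝ) : ℂ) *
        hermiteLayer f (μ / (2 * (k : ℝ) + d₁)) k w := by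
  rw [restOp, ← tsum_mul_left]
  refine tsum_congr fun k => ?_
  have h : ∀ ε : Metric.sphere (0 : EuclideanSpace ℝ (Fin d₂)) 1,
      μ * (∑ j, w.2 j * (ε : EuclideanSpace ℝ (Fin d₂)) j) / (2 * (k : ℝ) + d₁) =
        μ / (2 * (k : ℝ) + d₁) * ∑ j, w.2 j * (ε : EuclideanSpace ℝ (Fin d₂)) j := fun ε => by ring
  simp only [h]
  rw [integral_hermiteProj_eq_hermiteLayer, Complex.ofReal_mul (1 / (2 * Real.pi)), mul_assoc]

lemma hasC2Bound_hermiteLayer (f : SchwartzMap ((Fin d₁ → ℝ) × (Fin d₂ → ℝ)) ℂ) {a A : ℝ} (k : ℕ)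
    (R : ℝ) (hA : 1 ≤ A) (hak : √|a| * √(k + 1) ≤ A) :
    HasC2Bound (Metric.ball (0 : (Fin d₁ → ℝ) × (Fin d₂ → ℝ)) R) (hermiteLayer f a k)
      (4 * (64 * A ^ 2 * (1 + (A * R) ^ 2) ^ 2) ^ d₁ *
        ((1 + |a| * ‖coordPairing d₂‖) ^ 2 * (sphereMeasure d₂).real univ * (8 * A ^ 2) ^ d₁ *
          ∫ z, ‖f z‖ * (1 + ‖z‖ ^ 2) ^ d₁) *
        (√|a| ^ d₁ * ∑ ν ∈ Finset.Nat.antidiagonalTuple d₁ k, ∏ j, hermiteRate (ν j) ^ 2)) := by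
  have hα : |a| ^ ((d₁ : ℝ) / 4) * |a| ^ ((d₁ : ℝ) / 4) = √|a| ^ d₁ := by
    rw [← Real.rpow_add_of_nonneg (abs_nonneg a) (by positivity) (by positivity),
      Real.sqrt_eq_rpow, ← Real.rpow_natCast, ← Real.rpow_mul (abs_nonneg a)]
    congr 1
    ring
  have h1k : 1 ≤ √((k : ℝ) + 1) := by
    rw [Real.one_le_sqrt]
    have : (0 : ℝ) ≤ k := k.cast_nonneg
    linarith
  have haA : √|a| ≤ A := (le_mul_of_one_le_right (Real.sqrt_nonneg _) h1k).trans hak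
  refine (HasC2Bound.sum (Finset.Nat.antidiagonalTuple d₁ k) (M := fun ν =>
    4 * ((|a| ^ ((d₁ : ℝ) / 4) * ((64 * A ^ 2 * (1 + (A * R) ^ 2) ^ 2) ^ d₁ *
      ∏ j, hermiteRate (ν j))) * ((1 + |a| * ‖coordPairing d₂‖) ^ 2 *
        (sphereMeasure d₂).real univ * (|a| ^ ((d₁ : ℝ) / 4) * (8 * A ^ 2) ^ d₁ *
          (∏ j, hermiteRate (ν j)) * ∫ z, ‖f z‖ * (1 + ‖z‖ ^ 2) ^ d₁))))
    fun ν hν => ?_).mono (le_of_eq ?_)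
  · have hν' : ∀ j, √|a| * √(ν j + 1) ≤ A := fun j => by
      refine le_trans ?_ hak
      have h1 : ν j ≤ k := by
        rw [← Finset.Nat.mem_antidiagonalTuple.1 hν]
        exact Finset.single_le_sum (fun _ _ => Nat.zero_le _) (Finset.mem_univ j)
      gcongr
    refine (hasC2Bound_scaledHermite hA hν').mul ?_
    exact ((hasC2Bound_sphereTransform (continuous_partialHermiteCoeff f a ν) a
      fun v _ => norm_partialHermiteCoeff_le f ν hA haA v).comp_clm
        (ContinuousLinearMap.snd ℝ (Fin d₁ → ℝ) (Fin d₂ → ℝ))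
        (ContinuousLinearMap.norm_snd_le _ _ _)).subset fun _ _ => mem_univ _
  · simp only [Finset.mul_sum]
    refine Finset.sum_congr rfl fun ν _ => ?_
    rw [← hα, Finset.prod_pow]
    ring

lemma contDiff_hermiteLayer (f : SchwartzMap ((Fin d₁ → ℝ) × (Fin d₂ → ℝ)) ℂ) (a : ℝ) (k : ℕ) :
    ContDiff ℝ 2 (hermiteLayer f a k) :=
  (hasC2Bound_hermiteLayer f (A := 1 + √|a| * √(k + 1)) k 0
    (by simp; positivity) (by linarith)).1

lemma hasLineDerivAt_fst_mul {φ : (Fin d₁ → ℝ) → ℝ} {φ' : ℝ} {B : (Fin d₂ → ℝ) → ℂ}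
    {e : Fin d₁ → ℝ} {w : (Fin d₁ → ℝ) × (Fin d₂ → ℝ)} (h : HasLineDerivAt ℝ φ φ' w.1 e) :
    HasLineDerivAt ℝ (fun w : (Fin d₁ → ℝ) × (Fin d₂ → ℝ) => (φ w.1 : ℂ) * B w.2)
      (φ' * B w.2) w (e, 0) := by
  have h1 : HasDerivAt (fun s : ℝ => ((φ (w.1 + s • e) : ℝ) : ℂ)) (φ' : ℂ) 0 :=
    HasDerivAt.ofReal_comp h
  have h2 := h1.mul_const (B w.2)
  rw [HasLineDerivAt]
  simpa using h2

lemma hasLineDerivAt_mul_snd {φ : (Fin d₁ → ℝ) → ℝ} {B : (Fin d₂ → ℝ) → ℂ} {B' : ℂ}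
    {e : Fin d₂ → ℝ} {w : (Fin d₁ → ℝ) × (Fin d₂ → ℝ)} (h : HasLineDerivAt ℝ B B' w.2 e) :
    HasLineDerivAt ℝ (fun w : (Fin d₁ → ℝ) × (Fin d₂ → ℝ) => (φ w.1 : ℂ) * B w.2)
      (φ w.1 * B') w (0, e) := by
  have h1 : HasDerivAt (fun s : ℝ => B (w.2 + s • e)) B' 0 := h
  have h2 := h1.const_mul (φ w.1 : ℂ)
  rw [HasLineDerivAt]
  simpa using h2

lemma hasLineDerivAt_finsetSum {ι E : Type*} [NormedAddCommGroup E] [NormedSpace ℝ E]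
    (s : Finset ι) {g : ι → E → ℂ} {g' : ι → ℂ} {w e : E}
    (h : ∀ i ∈ s, HasLineDerivAt ℝ (g i) (g' i) w e) :
    HasLineDerivAt ℝ (fun w => ∑ i ∈ s, g i w) (∑ i ∈ s, g' i) w e :=
  HasDerivAt.fun_sum h

lemma secondDirDeriv_hermiteLayer_fst (f : SchwartzMap ((Fin d₁ → ℝ) × (Fin d₂ → ℝ)) ℂ) (a : ℝ)
    (k : ℕ) (j : Fin d₁) (z : (Fin d₁ → ℝ) × (Fin d₂ → ℝ)) :
    secondDirDeriv (hermiteLayer f a k) ((Pi.single j 1 : Fin d₁ → ℝ), 0) z =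
      ∑ ν ∈ Finset.Nat.antidiagonalTuple d₁ k,
        ((|a| * (|a| * z.1 j ^ 2 - (2 * ν j + 1)) * scaledHermite d₁ a ν z.1 : ℝ) : ℂ) *
          sphereTransform (partialHermiteCoeff f a ν) a z.2 :=
  secondDirDeriv_eq_of_hasLineDerivAt (contDiff_hermiteLayer f a k)
    (fun _ => hasLineDerivAt_finsetSum _ fun ν _ =>
      hasLineDerivAt_fst_mul (hasLineDerivAt_scaledHermite d₁ a ν j _))
    (hasLineDerivAt_finsetSum _ fun ν _ =>
      hasLineDerivAt_fst_mul (hasLineDerivAt_scaledHermiteDeriv d₁ a ν j _))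

lemma secondDirDeriv_hermiteLayer_snd (f : SchwartzMap ((Fin d₁ → ℝ) × (Fin d₂ → ℝ)) ℂ) (a : ℝ)
    (k : ℕ) (j : Fin d₂) (z : (Fin d₁ → ℝ) × (Fin d₂ → ℝ)) :
    secondDirDeriv (hermiteLayer f a k) (0, (Pi.single j 1 : Fin d₂ → ℝ)) z =
      ∑ ν ∈ Finset.Nat.antidiagonalTuple d₁ k, (scaledHermite d₁ a ν z.1 : ℂ) *
        sphereTransform (fun v => -Complex.I * ((a * v j : ℝ) : ℂ) *
          (-Complex.I * ((a * v j : ℝ) : ℂ) * partialHermiteCoeff f a ν v)) a z.2 := by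
  have hc := continuous_partialHermiteCoeff (d₁ := d₁) (d₂ := d₂) f a
  exact secondDirDeriv_eq_of_hasLineDerivAt (contDiff_hermiteLayer f a k)
    (fun _ => hasLineDerivAt_finsetSum _ fun ν _ =>
      hasLineDerivAt_mul_snd (hasLineDerivAt_sphereTransform (hc ν) a j _))
    (hasLineDerivAt_finsetSum _ fun ν _ =>
      hasLineDerivAt_mul_snd (hasLineDerivAt_sphereTransform
        (by have := hc ν; fun_prop) a j _))

lemma grushinOp_eq (u : (Fin d₁ → ℝ) × (Fin d₂ → ℝ) → ℂ) (z : (Fin d₁ → ℝ) × (Fin d₂ → ℝ)) :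
    grushinOp d₁ d₂ u z = -(∑ j, secondDirDeriv u ((Pi.single j 1 : Fin d₁ → ℝ), 0) z) -
      ((∑ i, z.1 i ^ 2 : ℝ) : ℂ) *
        ∑ j, secondDirDeriv u (0, (Pi.single j 1 : Fin d₂ → ℝ)) z :=
  rfl

lemma grushinOp_hermiteLayer (f : SchwartzMap ((Fin d₁ → ℝ) × (Fin d₂ → ℝ)) ℂ) {a : ℝ}
    (ha : 0 ≤ a) (k : ℕ) (z : (Fin d₁ → ℝ) × (Fin d₂ → ℝ)) :
    grushinOp d₁ d₂ (hermiteLayer f a k) z =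
      ((a * (2 * k + d₁) : ℝ) : ℂ) * hermiteLayer f a k z := by
  simp only [grushinOp_eq, secondDirDeriv_hermiteLayer_fst, secondDirDeriv_hermiteLayer_snd,
    abs_of_nonneg ha]
  rw [Finset.sum_comm, Finset.sum_comm (s := (Finset.univ : Finset (Fin d₂))), hermiteLayer,
    Finset.mul_sum, Finset.mul_sum, ← Finset.sum_neg_distrib, ← Finset.sum_sub_distrib]
  refine Finset.sum_congr rfl fun ν hν => ?_
  rw [← Finset.mul_sum, ← Finset.sum_mul,
    sum_sphereTransform_sq (continuous_partialHermiteCoeff f a ν), ← Complex.ofReal_sum,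
    ← Finset.sum_mul, ← Finset.mul_sum, Finset.sum_sub_distrib, ← Finset.mul_sum]
  have h1 : ∑ j, (2 * (ν j : ℝ) + 1) = 2 * k + d₁ := by
    rw [Finset.sum_add_distrib, ← Finset.mul_sum, ← Nat.cast_sum,
      Finset.Nat.mem_antidiagonalTuple.1 hν]
    simp
  rw [h1]
  push_cast
  ring

end Layer

lemma freq_bounds {d₁ : ℕ} (hd₁ : 1 ≤ d₁) {μ : ℝ} (hμ : 0 < μ) (k : ℕ) :
    0 ≤ μ / (2 * (k : ℝ) + d₁) ∧ μ / (2 * (k : ℝ) + d₁) ≤ μ ∧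
      √|μ / (2 * (k : ℝ) + d₁)| * √(k + 1) ≤ 1 + μ := by
  have hk : (0 : ℝ) ≤ k := k.cast_nonneg
  have hd : (1 : ℝ) ≤ d₁ := by exact_mod_cast hd₁
  have hpos : 0 < 2 * (k : ℝ) + d₁ := by linarith
  have h0 : 0 ≤ μ / (2 * (k : ℝ) + d₁) := by positivity
  refine ⟨h0, div_le_self hμ.le (by linarith), ?_⟩
  rw [abs_of_nonneg h0, ← Real.sqrt_mul h0, Real.sqrt_le_left (by linarith)]
  calc μ / (2 * (k : ℝ) + d₁) * (k + 1) = μ * ((k + 1) / (2 * (k : ℝ) + d₁)) := by ring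
    _ ≤ μ * 1 := by
        gcongr
        rw [div_le_one hpos]
        linarith
    _ ≤ _ := by nlinarith

lemma sqrt_pow_mul_sum_hermiteRate_le {d : ℕ} (hd : 1 ≤ d) {r A : ℝ} (hr : 0 ≤ r) (k : ℕ)
    (hrA : r * √(k + 1) ≤ A) :
    r ^ d * ∑ ν ∈ Finset.Nat.antidiagonalTuple d k, ∏ j, hermiteRate (ν j) ^ 2 ≤
      4 ^ d * A ^ d * ((k : ℝ) + 1)⁻¹ := by
  obtain ⟨e, rfl⟩ : ∃ e, d = e + 1 := ⟨d - 1, by omega⟩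
  have h := sum_antidiagonalTuple_hermiteRate_le e k
  have hk : (0 : ℝ) < (k : ℝ) + 1 := by positivity
  have hp : √((k : ℝ) + 1) * √((k : ℝ) + 1) = k + 1 := Real.mul_self_sqrt hk.le
  set S := ∑ ν ∈ Finset.Nat.antidiagonalTuple (e + 1) k, ∏ j, hermiteRate (ν j) ^ 2
  set p := √((k : ℝ) + 1)
  have hp0 : 0 ≤ p := Real.sqrt_nonneg _
  have hA : 0 ≤ A := (by positivity : 0 ≤ r * p).trans hrA
  rw [← div_eq_mul_inv, le_div_iff₀ hk, ← hp]
  calc r ^ (e + 1) * S * (p * p) = r ^ (e + 1) * p * (S * p) := by ring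
    _ ≤ r ^ (e + 1) * p * (4 ^ e * p ^ e) := by gcongr
    _ = 4 ^ e * (r * p) ^ (e + 1) := by ring
    _ ≤ 4 ^ (e + 1) * A ^ (e + 1) := by
        gcongr
        · norm_num
        · omega

lemma measure_const_le {d₁ d₂ : ℕ} (hd₁ : 1 ≤ d₁) (hd₂ : 1 ≤ d₂) {μ : ℝ} (hμ : 0 < μ) (k : ℕ) :
    ‖((1 / (2 * Real.pi) * (μ ^ (d₂ - 1) / (2 * (k : ℝ) + d₁) ^ d₂) : ℝ) : ℂ)‖ ≤
      1 / (2 * Real.pi) * μ ^ (d₂ - 1) * ((k : ℝ) + 1)⁻¹ := by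
  have hk : (0 : ℝ) ≤ k := k.cast_nonneg
  have hd : (1 : ℝ) ≤ d₁ := by exact_mod_cast hd₁
  rw [Complex.norm_real, Real.norm_of_nonneg (by positivity), mul_assoc, ← div_eq_mul_inv]
  gcongr
  calc (k : ℝ) + 1 ≤ 2 * (k : ℝ) + d₁ := by linarith
    _ ≤ _ := le_self_pow₀ (by linarith) (by omega)

lemma secondDirDeriv_const_mul {E : Type*} [NormedAddCommGroup E] [NormedSpace ℝ E] {u : E → ℂ}
    (hu : ContDiff ℝ 2 u) (c : ℂ) (e z : E) :
    secondDirDeriv (fun w => c * u w) e z = c * secondDirDeriv u e z := by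
  have h1 : ∀ w, fderiv ℝ (fun w => c * u w) w e = c * fderiv ℝ u w e := fun w => by
    rw [fderiv_const_mul (hu.differentiable (by norm_num) w)]; simp
  have h2 : DifferentiableAt ℝ (fun w => fderiv ℝ u w e) z :=
    (((ContinuousLinearMap.apply ℝ ℂ e).hasFDerivAt (x := fderiv ℝ u z)).comp z
      (hasFDerivAt_fderiv hu z)).differentiableAt
  rw [secondDirDeriv, funext h1, fderiv_const_mul h2]
  simp [secondDirDeriv]

lemma grushinOp_const_mul {d₁ d₂ : ℕ} {u : (Fin d₁ → ℝ) × (Fin d₂ → ℝ) → ℂ}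
    (hu : ContDiff ℝ 2 u) (c : ℂ) (z : (Fin d₁ → ℝ) × (Fin d₂ → ℝ)) :
    grushinOp d₁ d₂ (fun w => c * u w) z = c * grushinOp d₁ d₂ u z := by
  simp only [grushinOp_eq, secondDirDeriv_const_mul hu, ← Finset.mul_sum]
  ring

lemma hasSum_grushinOp {d₁ d₂ : ℕ} {T : ℕ → (Fin d₁ → ℝ) × (Fin d₂ → ℝ) → ℂ} {b : ℕ → ℝ}
    (hb : Summable b) {s : Set ((Fin d₁ → ℝ) × (Fin d₂ → ℝ))} (hs : IsOpen s)
    (hs' : IsPreconnected s) (hT : ∀ k, HasC2Bound s (T k) (b k))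
    {z : (Fin d₁ → ℝ) × (Fin d₂ → ℝ)} (hz : z ∈ s) :
    HasSum (fun k => grushinOp d₁ d₂ (T k) z) (grushinOp d₁ d₂ (fun w => ∑' k, T k w) z) := by
  simp only [grushinOp_eq]
  exact ((hasSum_sum fun j _ => secondDirDeriv_tsum hb hs hs' hT hz _).neg).sub
    ((hasSum_sum fun j _ => secondDirDeriv_tsum hb hs hs' hT hz _).mul_left _)

lemma exists_summable_hasC2Bound_hermiteLayer {d₁ d₂ : ℕ} (hd₁ : 1 ≤ d₁) (hd₂ : 1 ≤ d₂)
    (f : SchwartzMap ((Fin d₁ → ℝ) × (Fin d₂ → ℝ)) ℂ) {μ : ℝ} (hμ : 0 < μ) (R : ℝ) :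
    ∃ b : ℕ → ℝ, Summable b ∧ ∀ k : ℕ,
      HasC2Bound (Metric.ball (0 : (Fin d₁ → ℝ) × (Fin d₂ → ℝ)) R)
        (fun w => ((1 / (2 * Real.pi) * (μ ^ (d₂ - 1) / (2 * (k : ℝ) + d₁) ^ d₂) : ℝ) : ℂ) *
          hermiteLayer f (μ / (2 * (k : ℝ) + d₁)) k w) (b k) := by
  set A := 1 + μ with hA
  have hA1 : 1 ≤ A := by linarith
  have hK : 0 ≤ ∫ z, ‖f z‖ * (1 + ‖z‖ ^ 2) ^ d₁ := integral_nonneg fun z => by positivity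
  set K := ∫ z, ‖f z‖ * (1 + ‖z‖ ^ 2) ^ d₁
  refine ⟨fun k => 1 / (2 * Real.pi) * μ ^ (d₂ - 1) * ((k : ℝ) + 1)⁻¹ *
    (4 * (64 * A ^ 2 * (1 + (A * R) ^ 2) ^ 2) ^ d₁ *
      ((1 + μ * ‖coordPairing d₂‖) ^ 2 * (sphereMeasure d₂).real univ * (8 * A ^ 2) ^ d₁ * K) *
      (4 ^ d₁ * A ^ d₁ * ((k : ℝ) + 1)⁻¹)), ?_, fun k => ?_⟩
  · have h1 : Summable fun k : ℕ => (((k : ℝ) + 1) ^ 2)⁻¹ := by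
      have := (summable_nat_add_iff 1).2 (Real.summable_nat_pow_inv.2 (le_refl 2))
      simpa using this
    refine (h1.mul_left (1 / (2 * Real.pi) * μ ^ (d₂ - 1) *
      (4 * (64 * A ^ 2 * (1 + (A * R) ^ 2) ^ 2) ^ d₁ *
      ((1 + μ * ‖coordPairing d₂‖) ^ 2 * (sphereMeasure d₂).real univ * (8 * A ^ 2) ^ d₁ * K) *
      (4 ^ d₁ * A ^ d₁)))).congr fun k => ?_
    rw [sq ((k : ℝ) + 1), mul_inv]
    ring
  · obtain ⟨h0, h1, h2⟩ := freq_bounds hd₁ hμ k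
    refine ((hasC2Bound_hermiteLayer f k R hA1 h2).const_smul _).mono ?_
    have h3 := sqrt_pow_mul_sum_hermiteRate_le hd₁ (Real.sqrt_nonneg _) k h2
    have h4 : (1 + |μ / (2 * (k : ℝ) + d₁)| * ‖coordPairing d₂‖) ^ 2 ≤
        (1 + μ * ‖coordPairing d₂‖) ^ 2 := by
      rw [abs_of_nonneg h0]
      gcongr
    refine mul_le_mul (measure_const_le hd₁ hd₂ hμ k) (mul_le_mul ?_ h3 ?_ ?_) ?_ ?_
    · gcongr
    · exact mul_nonneg (by positivity) (Finset.sum_nonneg fun ν _ =>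
        Finset.prod_nonneg fun j _ => sq_nonneg _)
    · positivity
    · exact mul_nonneg (by positivity) (mul_nonneg (by positivity) (Finset.sum_nonneg fun ν _ =>
        Finset.prod_nonneg fun j _ => sq_nonneg _))
    · positivity

end EigenfunctionAuxiliary

theorem restriction_op_eigenfunction (d₁ d₂ : ℕ) (hd₁ : 1 ≤ d₁) (hd₂ : 1 ≤ d₂)
    (f : SchwartzMap ((Fin d₁ → ℝ) × (Fin d₂ → ℝ)) ℂ) (μ : ℝ) (hμ : 0 < μ) :
    ∀ z : (Fin d₁ → ℝ) × (Fin d₂ → ℝ),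
      grushinOp d₁ d₂ (fun w => restOp d₁ d₂ μ (⇑f) w.1 w.2) z =
        (μ : ℂ) * restOp d₁ d₂ μ (⇑f) z.1 z.2 := by
  intro z
  obtain ⟨b, hb, hT⟩ := exists_summable_hasC2Bound_hermiteLayer hd₁ hd₂ f hμ (‖z‖ + 1)
  have h := hasSum_grushinOp hb Metric.isOpen_ball (convex_ball _ _).isPreconnected hT
    (z := z) (by simp)
  simp only [restOp_eq_tsum]
  rw [← h.tsum_eq, ← tsum_mul_left]
  refine tsum_congr fun k => ?_
  have hd : (1 : ℝ) ≤ d₁ := by exact_mod_cast hd₁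
  have hne : 2 * (k : ℝ) + d₁ ≠ 0 := by positivity
  rw [grushinOp_const_mul (contDiff_hermiteLayer f _ k),
    grushinOp_hermiteLayer f (freq_bounds hd₁ hμ k).1, div_mul_cancel₀ μ hne]
  ring
end
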